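/- Let β ∈ {1,2,4}, α > −1, δ > −2, and let n ≥ 1 be an integer (with n ≥ 3 if β = 1 and n ≥ 2 if β = 4, so that n − i(β) ≥ 1). Then each σ_m^{(β)} is infinitely differentiable on ℝ² and the mixed cumulant generating function σ_n^{(β)}(z,w) satisfies, for all (z,w) ∈ ℝ², the nonlinear PDE: η^{(β)} w ∂_z^4 σ_n + 6 η^{(β)} w (∂_z^2 σ_n)² + 2z ∂_z∂_w σ_n + 3w ∂_w^2 σ_n + 2 ∂_w σ_n + (2(α + δ/2 + nβ + 2 − β) − w) ∂_z^2 σ_n = (12 b_n^{(β)}/β) · w · exp(σ_{n−i(β)} + σ_{n+i(β)} − 2σ_n), where the right-hand side σ's are all evaluated at the same point (z,w). -/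

import Mathlib

open MeasureTheory Filter Finset

/-- The β-deformed Vandermonde interaction factor `∏_{j<k} |T_k - T_j|^β`. -/
noncomputable def vand (β : ℝ) {n : ℕ} (T : Fin n → ℝ) : ℝ :=
  ∏ j, ∏ k ∈ Finset.Ioi j, |T k - T j| ^ β

/-- The Jacobi-ensemble weight `∏_j T_j^α (1-T_j)^{δ/2} ∏_{j<k} |T_k-T_j|^β`. -/
noncomputable def jacW (β α δ : ℝ) (n : ℕ) (T : Fin n → ℝ) : ℝ :=
  (∏ j, T j ^ α * (1 - T j) ^ (δ / 2)) * vand β T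

/-- Selberg's integral `c_n^{(β)}`. -/
noncomputable def cSel (β α δ : ℝ) (n : ℕ) : ℝ :=
  ∫ T in Set.Icc (0 : Fin n → ℝ) 1, jacW β α δ n T

/-- The joint moment generating function `M_n^{(β)}(z,w)` of conductance and shot noise. -/
noncomputable def Mjoint (β α δ : ℝ) (n : ℕ) (z w : ℝ) : ℝ :=
  (∫ T in Set.Icc (0 : Fin n → ℝ) 1,
      Real.exp (∑ j, (-(z * T j) - w * T j * (1 - T j))) * jacW β α δ n T) / cSel β α δ n

/-- The joint cumulant generating function `σ_n^{(β)}(z,w) = log M_n^{(β)}(z,w)`. -/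
noncomputable def sigJoint (β α δ : ℝ) (n : ℕ) (z w : ℝ) : ℝ :=
  Real.log (Mjoint β α δ n z w)

/-- The joint cumulants `κ_{l,k}^{(β)}(n) = (-1)^{l+k} ∂_z^l ∂_w^k σ_n^{(β)}(0,0)`. -/
noncomputable def kappaJ (β α δ : ℝ) (l k : ℕ) (n : ℕ) : ℝ :=
  (-1 : ℝ) ^ (l + k) *
    iteratedDeriv l (fun z => iteratedDeriv k (fun w => sigJoint β α δ n z w) 0) 0


open Classical in
/-- The constant `b_n^{(β)}` built from ratios of Selberg integrals. -/
noncomputable def bcoef (β α δ : ℝ) (n : ℕ) : ℝ :=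
  if β = 1 then
    ((n : ℝ) * (n - 1) / ((n + 1) * (n + 2))) *
      (cSel 1 α δ (n - 2) * cSel 1 α δ (n + 2)) / (cSel 1 α δ n) ^ 2
  else if β = 4 then
    ((n : ℝ) / (n + 1)) * (cSel 4 α δ (n - 1) * cSel 4 α δ (n + 1)) / (cSel 4 α δ n) ^ 2
  else 0

open Classical in
/-- The parameter `η^{(β)}`: 4 if β = 4, otherwise 1. -/
noncomputable def eta (β : ℝ) : ℝ := if β = 4 then 4 else 1

open Classical in
/-- The shift `i(β)`: 1 if β = 4, otherwise 2. -/
noncomputable def ibeta (β : ℝ) : ℕ := if β = 4 then 1 else 2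

section SplitSum

variable {ι R Q : Type*} [LinearOrder ι] [CommRing R] [CommRing Q]

/-- The product of a symmetric kernel over the unordered pairs of a finite set. -/
def pairProd (h : ι → ι → R) (S : Finset ι) : R :=
  ∏ i ∈ S, ∏ j ∈ S, if i < j then h i j else 1

lemma pairProd_insert {h : ι → ι → R} (hs : ∀ i j, h i j = h j i) {a : ι} {S : Finset ι}
    (ha : a ∉ S) : pairProd h (insert a S) = (∏ j ∈ S, h a j) * pairProd h S := by
  have key : ∀ i ∈ S, (if a < i then h a i else 1) * (if i < a then h i a else 1) = h a i := by
    intro i hi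
    rcases lt_trichotomy a i with h1 | h1 | h1
    · simp [h1, h1.not_gt]
    · exact absurd (h1 ▸ hi) ha
    · simp [h1, h1.not_gt, hs a i]
  unfold pairProd
  rw [Finset.prod_insert ha, Finset.prod_insert ha, if_neg (lt_irrefl a), one_mul,
    Finset.prod_congr rfl fun i _ => Finset.prod_insert ha, Finset.prod_mul_distrib, ← mul_assoc,
    ← Finset.prod_mul_distrib, Finset.prod_congr rfl key]

@[simp] lemma pairProd_empty (h : ι → ι → R) : pairProd h ∅ = 1 := by simp [pairProd]

lemma map_pairProd (f : R →+* Q) (h : ι → ι → R) (S : Finset ι) :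
    f (pairProd h S) = pairProd (fun i j => f (h i j)) S := by
  simp only [pairProd, map_prod, apply_ite f, map_one]

lemma pairProd_mul (h k : ι → ι → R) (S : Finset ι) :
    pairProd (fun i j => h i j * k i j) S = pairProd h S * pairProd k S := by
  simp only [pairProd, ← Finset.prod_mul_distrib]
  refine Finset.prod_congr rfl fun i _ => Finset.prod_congr rfl fun j _ => ?_
  split_ifs <;> simp

lemma pairProd_congr {h k : ι → ι → R} {S : Finset ι}
    (hk : ∀ i ∈ S, ∀ j ∈ S, i < j → h i j = k i j) : pairProd h S = pairProd k S := by
  refine Finset.prod_congr rfl fun i hi => Finset.prod_congr rfl fun j hj => ?_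
  split_ifs with hij
  · exact hk i hi j hj hij
  · rfl

/-- The weight of a splitting of a finite set of points into two parts, as a function of the
differences of the power sums of degrees `0, 1, 2, 3` over the two parts. -/
def splitWeight (η c s : ℕ) (d₀ : ℤ) (d₁ d₂ d₃ : R) : R :=
  if d₀ = 0 then η * d₁ ^ 4 + 3 * d₂ ^ 2 - 4 * d₁ * d₃ else if d₀ = -(2 * s) then -c else 0

/-- The contribution of the splitting `(S, T)` to `splitSum`. -/
def splitTerm (η c s : ℕ) (h : ι → ι → R) (x : ι → R) (S T : Finset ι) : R :=
  pairProd h S * pairProd h T * splitWeight η c s ((#S : ℤ) - #T)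
    (∑ i ∈ S, x i - ∑ i ∈ T, x i) (∑ i ∈ S, x i ^ 2 - ∑ i ∈ T, x i ^ 2)
    (∑ i ∈ S, x i ^ 3 - ∑ i ∈ T, x i ^ 3)

/-- The sum of `splitTerm` over all splittings of `U` into two parts. -/
def splitSum (η c s : ℕ) (h : ι → ι → R) (x : ι → R) (U : Finset ι) : R :=
  ∑ S ∈ U.powerset, splitTerm η c s h x S (U \ S)

variable {η c s : ℕ}

lemma map_splitWeight (f : R →+* Q) (d₀ : ℤ) (d₁ d₂ d₃ : R) :
    f (splitWeight η c s d₀ d₁ d₂ d₃) = splitWeight η c s d₀ (f d₁) (f d₂) (f d₃) := by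
  unfold splitWeight
  split_ifs <;> simp [map_ofNat f]

lemma map_splitSum (f : R →+* Q) (h : ι → ι → R) (x : ι → R) (U : Finset ι) :
    f (splitSum η c s h x U) = splitSum η c s (fun i j => f (h i j)) (fun i => f (x i)) U := by
  simp only [splitSum, splitTerm, map_sum, map_mul, map_pairProd, map_splitWeight, map_sub, map_pow]

lemma splitTerm_insert_self {h : ι → ι → R} (hs : ∀ i j, h i j = h j i) {x : ι → R} {a b : ι}
    (hab : a ≠ b) (h0 : h a b = 0) {S T : Finset ι} (ha : a ∉ S) (hb : b ∉ S) :
    splitTerm η c s h x (insert a (insert b S)) T = 0 ∧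
      splitTerm η c s h x T (insert a (insert b S)) = 0 := by
  have : pairProd h (insert a (insert b S)) = 0 := by
    rw [pairProd_insert hs (by simp [hab, ha]), Finset.prod_insert hb, h0]
    simp
  constructor <;> simp [splitTerm, this]

lemma splitTerm_insert {h : ι → ι → R} (hs : ∀ i j, h i j = h j i) {x : ι → R} {a b : ι}
    {S T : Finset ι} (ha : a ∉ S) (hb : b ∉ T) :
    splitTerm η c s h x (insert a S) (insert b T) =
      (∏ j ∈ S, h a j) * (∏ j ∈ T, h b j) * (pairProd h S * pairProd h T *
        splitWeight η c s ((#S : ℤ) - #T)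
        (x a - x b + (∑ i ∈ S, x i - ∑ i ∈ T, x i))
        (x a ^ 2 - x b ^ 2 + (∑ i ∈ S, x i ^ 2 - ∑ i ∈ T, x i ^ 2))
        (x a ^ 3 - x b ^ 3 + (∑ i ∈ S, x i ^ 3 - ∑ i ∈ T, x i ^ 3))) := by
  have e0 : ((#(insert a S) : ℕ) : ℤ) - (#(insert b T) : ℕ) = #S - #T := by
    rw [card_insert_of_notMem ha, card_insert_of_notMem hb]; push_cast; ring
  have e : ∀ k : ℕ, ∑ i ∈ insert a S, x i ^ k - ∑ i ∈ insert b T, x i ^ k =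
      x a ^ k - x b ^ k + (∑ i ∈ S, x i ^ k - ∑ i ∈ T, x i ^ k) := by
    intro k
    rw [sum_insert ha, sum_insert hb]; ring
  have e1 := e 1
  simp only [pow_one] at e1
  rw [splitTerm, e0, e1, e 2, e 3, pairProd_insert hs ha, pairProd_insert hs hb]
  ring

/-- Expansion of `splitSum` over the location of two distinguished points. -/
lemma splitSum_insert_insert (h : ι → ι → R) (x : ι → R) {a b : ι} (hab : a ≠ b) {U : Finset ι}
    (ha : a ∉ U) (hb : b ∉ U) :
    splitSum η c s h x (insert a (insert b U)) = ∑ S ∈ U.powerset,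
      (splitTerm η c s h x S (insert a (insert b (U \ S))) +
        splitTerm η c s h x (insert b S) (insert a (U \ S)) +
        (splitTerm η c s h x (insert a S) (insert b (U \ S)) +
        splitTerm η c s h x (insert a (insert b S)) (U \ S))) := by
  have ha' : a ∉ insert b U := by simp [hab, ha]
  unfold splitSum
  rw [sum_powerset_insert ha', sum_powerset_insert hb, sum_powerset_insert hb]
  simp only [← sum_add_distrib]
  refine sum_congr rfl fun S hS => ?_
  rw [mem_powerset] at hS
  have haS : a ∉ S := fun h => ha (hS h)
  have hbS : b ∉ S := fun h => hb (hS h)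
  have e1 : insert a (insert b U) \ S = insert a (insert b (U \ S)) := by grind
  have e2 : insert a (insert b U) \ insert b S = insert a (U \ S) := by grind
  have e3 : insert a (insert b U) \ insert a S = insert b (U \ S) := by grind
  have e4 : insert a (insert b U) \ insert a (insert b S) = U \ S := by grind
  rw [e1, e2, e3, e4]

/-- When two points collide, `splitSum` reduces to the remaining points. -/
lemma splitSum_of_collision {h : ι → ι → R} (hs : ∀ i j, h i j = h j i) {x : ι → R} {a b : ι}
    (hab : a ≠ b) (h0 : h a b = 0) (hx : x a = x b) {U : Finset ι} (ha : a ∉ U) (hb : b ∉ U) :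
    splitSum η c s h x (insert a (insert b U)) = ∑ S ∈ U.powerset,
      ((∏ j ∈ S, h b j) * (∏ j ∈ U \ S, h a j) + (∏ j ∈ S, h a j) * ∏ j ∈ U \ S, h b j) *
        splitTerm η c s h x S (U \ S) := by
  rw [splitSum_insert_insert h x hab ha hb]
  refine sum_congr rfl fun S hS => ?_
  rw [mem_powerset] at hS
  have haS : a ∉ S := fun h => ha (hS h)
  have hbS : b ∉ S := fun h => hb (hS h)
  rw [(splitTerm_insert_self hs hab h0 haS hbS).1,
    (splitTerm_insert_self hs hab h0 (S := U \ S) (by simp [ha]) (by simp [hb])).2,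
    splitTerm_insert hs hbS (by simp [ha]), splitTerm_insert hs haS (by simp [hb]), hx,
    splitTerm]
  simp only [sub_self, zero_add, add_zero]
  ring

end SplitSum

section Divisibility

open MvPolynomial

variable {ι : Type*} [LinearOrder ι]

/-- Substitution of `X b` for `X a`. -/
noncomputable def identifyVars (a b : ι) : MvPolynomial ι ℝ →ₐ[ℝ] MvPolynomial ι ℝ :=
  aeval (Function.update X a (X b))

lemma X_sub_X_dvd_iff {a b : ι} {p : MvPolynomial ι ℝ} :
    X a - X b ∣ p ↔ identifyVars a b p = 0 := by
  constructor
  · rintro ⟨q, rfl⟩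
    by_cases hab : b = a <;> simp [identifyVars, hab]
  · intro h
    have key : ∀ q : MvPolynomial ι ℝ, X a - X b ∣ q - identifyVars a b q := by
      intro q
      induction q using MvPolynomial.induction_on with
      | C r => simp [identifyVars]
      | add p q hp hq =>
        rw [map_add, add_sub_add_comm]
        exact dvd_add hp hq
      | mul_X p i hp =>
        have hi : X a - X b ∣ X i - identifyVars a b (X i) := by
          by_cases hia : i = a
          · subst hia; simp [identifyVars]
          · simp [identifyVars, hia]
        have : p * X i - identifyVars a b (p * X i) =
            (p - identifyVars a b p) * X i + identifyVars a b p * (X i - identifyVars a b (X i)) := by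
          rw [map_mul]; ring
        rw [this]
        exact dvd_add (hp.mul_right _) (hi.mul_left _)
    simpa [h] using key p

lemma X_sub_X_ne_zero {ι : Type*} {a b : ι} (hab : a ≠ b) : (X a - X b : MvPolynomial ι ℝ) ≠ 0 :=
  sub_ne_zero.2 fun h => hab (X_injective h)

lemma prime_X_sub_X {a b : ι} (hab : a ≠ b) : Prime (X a - X b : MvPolynomial ι ℝ) := by
  refine ⟨X_sub_X_ne_zero hab, fun h => ?_, fun p q h => ?_⟩
  · have := X_sub_X_dvd_iff.1 (h.dvd (a := 1))
    simp at this
  · rw [X_sub_X_dvd_iff, map_mul, mul_eq_zero] at h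
    rwa [X_sub_X_dvd_iff, X_sub_X_dvd_iff]

lemma isRelPrime_X_sub_X {a b c d : ι} (hab : a < b) (hcd : c < d) (h : (a, b) ≠ (c, d)) :
    IsRelPrime (X a - X b : MvPolynomial ι ℝ) (X c - X d) := by
  rw [(prime_X_sub_X hab.ne).irreducible.isRelPrime_iff_not_dvd, X_sub_X_dvd_iff]
  simp only [identifyVars, map_sub, aeval_X, Function.update_apply]
  rw [← Ne, sub_ne_zero]
  have hne : ∀ i j : ι, i ≠ j → (X i : MvPolynomial ι ℝ) ≠ X j :=
    fun i j hij h => hij (X_injective h)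
  split_ifs with h1 h2 h2
  · exact absurd (h1.trans h2.symm) hcd.ne
  · subst h1
    exact hne _ _ fun h3 => h (by rw [h3])
  · subst h2
    exact hne _ _ (hcd.trans hab).ne
  · exact hne _ _ hcd.ne

lemma pairProd_dvd {e : ℕ} {U : Finset ι} {p : MvPolynomial ι ℝ}
    (hp : ∀ i ∈ U, ∀ j ∈ U, i ≠ j → (X i - X j) ^ e ∣ p) :
    pairProd (fun i j => (X i - X j) ^ e) U ∣ p := by
  unfold pairProd
  rw [← Finset.prod_product']
  refine Finset.prod_dvd_of_isRelPrime ?_ ?_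
  · rintro ⟨i, j⟩ - ⟨k, l⟩ - hne
    simp only [Function.onFun]
    split_ifs with h1 h2 h2
    · exact (isRelPrime_X_sub_X h1 h2 hne).pow
    · exact isRelPrime_one_right
    · exact isRelPrime_one_left
    · exact isRelPrime_one_left
  · rintro ⟨i, j⟩ hij
    rw [mem_product] at hij
    split_ifs with h1
    · exact hp i hij.1 j hij.2 h1.ne
    · exact one_dvd _

lemma isHomogeneous_X_sub_X_pow {ι : Type*} (i j : ι) (e : ℕ) :
    ((X i - X j : MvPolynomial ι ℝ) ^ e).IsHomogeneous e := by
  simpa using ((isHomogeneous_X ℝ i).sub (isHomogeneous_X ℝ j)).pow e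

lemma pairProd_isHomogeneous {h : ι → ι → MvPolynomial ι ℝ} {e : ℕ}
    (hh : ∀ i j, (h i j).IsHomogeneous e) (U : Finset ι) :
    (pairProd h U).IsHomogeneous (e * (#U).choose 2) := by
  unfold pairProd
  have h1 : ∀ i ∈ U, ∀ j ∈ U, (if i < j then h i j else 1).IsHomogeneous
      (if i < j then e else 0) := by
    intro i _ j _
    split_ifs
    · exact hh i j
    · exact isHomogeneous_one ι ℝ
  have h2 := IsHomogeneous.prod U _ _ fun i hi => IsHomogeneous.prod U _ _ (h1 i hi)
  convert h2 using 1
  clear h1 h2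
  induction U using Finset.induction_on with
  | empty => simp
  | insert a U ha ih =>
    rw [card_insert_of_notMem ha, Nat.choose_succ_succ' (#U) 1, mul_add, ih,
      Nat.choose_one_right, sum_insert ha, sum_insert ha, if_neg (lt_irrefl a), zero_add,
      sum_congr rfl fun i _ => sum_insert ha, sum_add_distrib, ← add_assoc, ← sum_add_distrib,
      mul_comm, ← smul_eq_mul, ← sum_const]
    congr 1
    refine sum_congr rfl fun i hi => ?_
    rcases lt_trichotomy a i with h1 | h1 | h1
    · simp [h1, h1.not_gt]
    · exact absurd (h1 ▸ hi) ha
    · simp [h1, h1.not_gt]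

lemma pairProd_X_ne_zero (e : ℕ) (U : Finset ι) :
    pairProd (fun i j => (X i - X j : MvPolynomial ι ℝ) ^ e) U ≠ 0 := by
  refine Finset.prod_ne_zero_iff.2 fun i _ => Finset.prod_ne_zero_iff.2 fun j _ => ?_
  split_ifs with hij
  · exact pow_ne_zero _ (X_sub_X_ne_zero hij.ne)
  · exact one_ne_zero

/-- A homogeneous polynomial vanishing to order `e` on all diagonals of the variables in `U`
vanishes if its degree is too small. -/
lemma eq_zero_of_pow_dvd {e D : ℕ} {U : Finset ι} {p : MvPolynomial ι ℝ} (hD : p.IsHomogeneous D)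
    (hlt : D < e * (#U).choose 2) (hp : ∀ i ∈ U, ∀ j ∈ U, i ≠ j → (X i - X j) ^ e ∣ p) : p = 0 := by
  by_contra h0
  obtain ⟨q, hq⟩ := pairProd_dvd hp
  have hq0 : q ≠ 0 := by rintro rfl; simp at hq; exact h0 hq
  have := totalDegree_mul_of_isDomain (pairProd_X_ne_zero e U) hq0
  rw [← hq, hD.totalDegree h0,
    (pairProd_isHomogeneous (fun i j => isHomogeneous_X_sub_X_pow i j e) U).totalDegree
      (pairProd_X_ne_zero e U)]
    at this
  omega

/-- A polynomial symmetric in two variables and vanishing on their diagonal vanishes there to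
second order. -/
lemma sq_dvd_of_swap {a b : ι} (hab : a ≠ b) {p : MvPolynomial ι ℝ} (h : X a - X b ∣ p)
    (hs : rename (Equiv.swap a b) p = p) : (X a - X b) ^ 2 ∣ p := by
  obtain ⟨q, rfl⟩ := h
  have h1 : rename (Equiv.swap a b) q = -q := by
    have := hs
    simp only [map_mul, map_sub, rename_X, Equiv.swap_apply_left, Equiv.swap_apply_right] at this
    refine mul_left_cancel₀ (X_sub_X_ne_zero hab) ?_
    linear_combination -this
  have h2 : identifyVars a b (rename (Equiv.swap a b) q) = identifyVars a b q := by
    rw [identifyVars, aeval_rename]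
    congr 2
    ext i
    by_cases hia : i = a
    · subst hia; simp [hab.symm]
    · by_cases hib : i = b
      · subst hib; simp [hia]
      · simp [Equiv.swap_apply_of_ne_of_ne hia hib]
  rw [sq]
  refine mul_dvd_mul_left _ (X_sub_X_dvd_iff.2 ?_)
  rw [h1, map_neg] at h2
  exact neg_eq_self.1 h2

end Divisibility

section Identities

open MvPolynomial

variable {ι R : Type*} [LinearOrder ι] [CommRing R] {η c s : ℕ}

lemma choose_two_add (k l : ℕ) : (k + l).choose 2 = k.choose 2 + l.choose 2 + k * l := by
  have : ((k + l).choose 2 : ℚ) = (k.choose 2 + l.choose 2 + k * l : ℕ) := by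
    push_cast [Nat.cast_choose_two]; ring
  exact_mod_cast this

lemma splitSum_isHomogeneous {h : ι → ι → MvPolynomial ι ℝ} {e : ℕ}
    (hh : ∀ i j, (h i j).IsHomogeneous e) (hc : c = 0 ∨ e * s ^ 2 = 4) {n : ℕ} {U : Finset ι}
    (hU : #U = 2 * n) :
    (splitSum η c s h X U).IsHomogeneous (2 * e * n.choose 2 + 4) := by
  refine IsHomogeneous.sum _ _ _ fun S hS => ?_
  have hcard : #S + #(U \ S) = 2 * n := by
    rw [← hU, add_comm]
    exact card_sdiff_add_card_eq_card (mem_powerset.1 hS)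
  have hd : ∀ k : ℕ,
      (∑ i ∈ S, X i ^ k - ∑ i ∈ U \ S, X i ^ k : MvPolynomial ι ℝ).IsHomogeneous k := by
    intro k
    refine (IsHomogeneous.sum _ _ _ fun i _ => ?_).sub (IsHomogeneous.sum _ _ _ fun i _ => ?_) <;>
      simpa using (isHomogeneous_X ℝ i).pow k
  have h1 := hd 1
  simp only [pow_one] at h1
  have hST := (pairProd_isHomogeneous hh S).mul (pairProd_isHomogeneous hh (U \ S))
  unfold splitTerm splitWeight
  split_ifs with h0 h0'
  · have hk : #S = n := by omega
    have hl : #(U \ S) = n := by omega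
    rw [hk, hl] at hST
    have hw : ((η : MvPolynomial ι ℝ) * (∑ i ∈ S, X i - ∑ i ∈ U \ S, X i) ^ 4 +
        3 * (∑ i ∈ S, X i ^ 2 - ∑ i ∈ U \ S, X i ^ 2) ^ 2 -
        4 * (∑ i ∈ S, X i - ∑ i ∈ U \ S, X i) *
          (∑ i ∈ S, X i ^ 3 - ∑ i ∈ U \ S, X i ^ 3)).IsHomogeneous 4 := by
      have hC : ∀ r : ℝ, (C r : MvPolynomial ι ℝ).IsHomogeneous 0 := isHomogeneous_C ι
      have e1 := (hC η).mul (h1.pow 4)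
      have e2 := (hC 3).mul ((hd 2).pow 2)
      have e3 := ((hC 4).mul h1).mul (hd 3)
      simp only [map_natCast, map_ofNat, zero_add] at e1 e2 e3
      exact (e1.add e2).sub e3
    convert hST.mul hw using 1
    ring
  · obtain rfl | hes := hc
    · simpa using isHomogeneous_zero ι ℝ _
    · have hk : #S + s = n := by omega
      have hl : #(U \ S) = #S + (s + s) := by omega
      have hw : (-(c : MvPolynomial ι ℝ)).IsHomogeneous 0 := by
        simpa using (isHomogeneous_C ι (-(c : ℝ)))
      convert hST.mul hw using 1
      rw [hl, ← hk, choose_two_add, choose_two_add _ (s + s), choose_two_add s s, ← hes]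
      ring
  · simpa using isHomogeneous_zero ι ℝ _

/-- The kernel `(w i j * (x j - x i)) ^ e`. -/
def vdmKernel (w : ι → ι → ℤ) (e : ℕ) (x : ι → R) (i j : ι) : R := (w i j * (x j - x i)) ^ e

lemma map_vdmKernel {ι Q : Type*} [CommRing Q] (f : R →+* Q) (w : ι → ι → ℤ) (e : ℕ)
    (x : ι → R) (i j : ι) : f (vdmKernel w e x i j) = vdmKernel w e (fun i => f (x i)) i j := by
  simp [vdmKernel]

lemma vdmKernel_isHomogeneous {ι : Type*} (w : ι → ι → ℤ) (e : ℕ) (i j : ι) :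
    (vdmKernel w e (X : ι → MvPolynomial ι ℝ) i j).IsHomogeneous e := by
  have h1 := ((isHomogeneous_X ℝ j).sub (isHomogeneous_X ℝ i)).pow e
  have h2 := isHomogeneous_C ι ((w i j : ℝ) ^ e)
  simpa [vdmKernel, mul_pow] using h2.mul h1

lemma splitSum_aeval {w : ι → ι → ℤ} {e : ℕ} {U : Finset ι}
    (h : splitSum η c s (vdmKernel w e (X : ι → MvPolynomial ι ℝ)) X U = 0)
    {R : Type*} [CommRing R] [Algebra ℝ R] (x : ι → R) :
    splitSum η c s (vdmKernel w e x) x U = 0 := by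
  have := map_splitSum (η := η) (c := c) (s := s) (aeval (R := ℝ) x).toRingHom
    (vdmKernel w e X) X U
  rw [h, map_zero] at this
  simpa only [map_vdmKernel, AlgHom.toRingHom_eq_coe, RingHom.coe_coe, aeval_X] using this.symm

lemma dvd_splitSum_of_collision {w : ι → ι → ℤ} {e : ℕ} {U : Finset ι} {a b : ι}
    (h : splitSum η c s (vdmKernel w e (Function.update (X : ι → MvPolynomial ι ℝ) a (X b)))
      (Function.update (X : ι → MvPolynomial ι ℝ) a (X b)) U = 0) :
    X a - X b ∣ splitSum η c s (vdmKernel w e (X : ι → MvPolynomial ι ℝ)) X U := by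
  rw [X_sub_X_dvd_iff]
  have := map_splitSum (η := η) (c := c) (s := s) (identifyVars a b).toRingHom
    (vdmKernel w e X) X U
  simpa only [map_vdmKernel, AlgHom.toRingHom_eq_coe, RingHom.coe_coe, identifyVars, aeval_X, h]
    using this

@[simp] lemma splitSum_empty (h : ι → ι → R) (x : ι → R) : splitSum η c s h x ∅ = 0 := by
  simp [splitSum, splitTerm, splitWeight]

lemma pairProd_singleton (h : ι → ι → R) (a : ι) : pairProd h {a} = 1 := by simp [pairProd]

lemma pairProd_pair {h : ι → ι → R} (hs : ∀ i j, h i j = h j i) {a b : ι} (hab : a ≠ b) :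
    pairProd h {a, b} = h a b := by
  rw [pairProd_insert hs (by simpa using hab), pairProd_singleton]
  simp

lemma splitSum_pair_one {h : ι → ι → R} (hs : ∀ i j, h i j = h j i) (x : ι → R) {a b : ι}
    (hab : a ≠ b) : splitSum η c 1 h x {a, b} =
      2 * (η * (x a - x b) ^ 4 - (x a - x b) ^ 4) - c * h a b := by
  have := splitSum_insert_insert (η := η) (c := c) (s := 1) h x hab (U := ∅) (by simp) (by simp)
  rw [insert_empty_eq] at this
  rw [this]
  simp [splitTerm, splitWeight, pairProd_pair hs hab, pairProd_singleton, card_pair hab,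
    sum_pair hab]
  ring

lemma splitSum_pair_two (h : ι → ι → R) (x : ι → R) {a b : ι}
    (hab : a ≠ b) : splitSum η c 2 h x {a, b} =
      2 * (η * (x a - x b) ^ 4 - (x a - x b) ^ 4) := by
  have := splitSum_insert_insert (η := η) (c := c) (s := 2) h x hab (U := ∅) (by simp) (by simp)
  rw [insert_empty_eq] at this
  rw [this]
  simp [splitTerm, splitWeight, pairProd_singleton, card_pair hab]
  ring

lemma pairProd_four {h : ι → ι → R} (hs : ∀ i j, h i j = h j i) {a b c d : ι}
    (hab : a ≠ b) (hac : a ≠ c) (had : a ≠ d) (hbc : b ≠ c) (hbd : b ≠ d) (hcd : c ≠ d) :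
    pairProd h {a, b, c, d} = h a b * h a c * h a d * h b c * h b d * h c d := by
  rw [pairProd_insert hs (by simp [*]), pairProd_insert hs (by simp [*]), pairProd_pair hs hcd,
    prod_insert (by simp [*]), prod_pair hcd, prod_pair hcd]
  ring

lemma pairProd_three {h : ι → ι → R} (hs : ∀ i j, h i j = h j i) {a b c : ι}
    (hab : a ≠ b) (hac : a ≠ c) (hbc : b ≠ c) :
    pairProd h {a, b, c} = h a b * h a c * h b c := by
  rw [pairProd_insert hs (by simp [*]), pairProd_pair hs hbc, prod_pair hbc]

lemma sum_powerset_pair {M : Type*} [AddCommMonoid M] {a b : ι} (hab : a ≠ b)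
    (f : Finset ι → M) :
    ∑ S ∈ ({a, b} : Finset ι).powerset, f S = f ∅ + f {b} + (f {a} + f {a, b}) := by
  rw [sum_powerset_insert (by simpa using hab), ← insert_empty_eq b, sum_powerset_insert (by simp),
    sum_powerset_insert (by simp)]
  simp

lemma splitSum_four_two {h : ι → ι → R} (hs : ∀ i j, h i j = h j i) (x : ι → R) {a b p q : ι}
    (hab : a ≠ b) (hap : a ≠ p) (haq : a ≠ q) (hbp : b ≠ p) (hbq : b ≠ q) (hpq : p ≠ q) :
    splitSum η c 2 h x {a, b, p, q} =
      2 * (h a b * h p q * (η * (x a + x b - x p - x q) ^ 4 +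
          3 * (x a ^ 2 + x b ^ 2 - x p ^ 2 - x q ^ 2) ^ 2 - 4 * (x a + x b - x p - x q) *
          (x a ^ 3 + x b ^ 3 - x p ^ 3 - x q ^ 3)) +
        h a p * h b q * (η * (x a + x p - x b - x q) ^ 4 +
          3 * (x a ^ 2 + x p ^ 2 - x b ^ 2 - x q ^ 2) ^ 2 - 4 * (x a + x p - x b - x q) *
          (x a ^ 3 + x p ^ 3 - x b ^ 3 - x q ^ 3)) +
        h a q * h b p * (η * (x a + x q - x p - x b) ^ 4 +
          3 * (x a ^ 2 + x q ^ 2 - x p ^ 2 - x b ^ 2) ^ 2 - 4 * (x a + x q - x p - x b) *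
          (x a ^ 3 + x q ^ 3 - x p ^ 3 - x b ^ 3))) -
      c * (h a b * h a p * h a q * h b p * h b q * h p q) := by
  rw [splitSum_insert_insert h x hab (U := {p, q}) (by simp [*]) (by simp [*]),
    sum_powerset_pair hpq]
  have e1 : ({p, q} : Finset ι) \ {q} = {p} := by grind
  have e2 : ({p, q} : Finset ι) \ {p} = {q} := by grind
  simp only [e1, e2, insert_empty_eq, sdiff_self, sdiff_empty, bot_eq_empty]
  simp [splitTerm, splitWeight, pairProd_four, pairProd_pair, pairProd_singleton, *]
  ring

lemma splitSum_four_one {h : ι → ι → R} (hs : ∀ i j, h i j = h j i) (x : ι → R) {a b p q : ι}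
    (hab : a ≠ b) (hap : a ≠ p) (haq : a ≠ q) (hbp : b ≠ p) (hbq : b ≠ q) (hpq : p ≠ q) :
    splitSum η c 1 h x {a, b, p, q} =
      2 * (h a b * h p q * (η * (x a + x b - x p - x q) ^ 4 +
          3 * (x a ^ 2 + x b ^ 2 - x p ^ 2 - x q ^ 2) ^ 2 - 4 * (x a + x b - x p - x q) *
          (x a ^ 3 + x b ^ 3 - x p ^ 3 - x q ^ 3)) +
        h a p * h b q * (η * (x a + x p - x b - x q) ^ 4 +
          3 * (x a ^ 2 + x p ^ 2 - x b ^ 2 - x q ^ 2) ^ 2 - 4 * (x a + x p - x b - x q) *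
          (x a ^ 3 + x p ^ 3 - x b ^ 3 - x q ^ 3)) +
        h a q * h b p * (η * (x a + x q - x p - x b) ^ 4 +
          3 * (x a ^ 2 + x q ^ 2 - x p ^ 2 - x b ^ 2) ^ 2 - 4 * (x a + x q - x p - x b) *
          (x a ^ 3 + x q ^ 3 - x p ^ 3 - x b ^ 3))) -
      c * (h b p * h b q * h p q + h a p * h a q * h p q + h a b * h a q * h b q +
        h a b * h a p * h b p) := by
  rw [splitSum_insert_insert h x hab (U := {p, q}) (by simp [*]) (by simp [*]),
    sum_powerset_pair hpq]
  have e1 : ({p, q} : Finset ι) \ {q} = {p} := by grind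
  have e2 : ({p, q} : Finset ι) \ {p} = {q} := by grind
  simp only [e1, e2, insert_empty_eq, sdiff_self, sdiff_empty, bot_eq_empty]
  simp [splitTerm, splitWeight, pairProd_three, pairProd_pair, pairProd_singleton, *]
  ring

end Identities

section Vanishing

open MvPolynomial

variable {ι R : Type*} [LinearOrder ι] [CommRing R] {η c s : ℕ}

lemma exists_insert_insert {n : ℕ} {U : Finset ι} (hU : #U = n + 2) {a b : ι} (ha : a ∈ U)
    (hb : b ∈ U) (hab : a ≠ b) :
    ∃ V : Finset ι, V ⊆ U ∧ #V = n ∧ a ∉ V ∧ b ∉ V ∧ U = insert a (insert b V) := by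
  refine ⟨(U.erase a).erase b, (erase_subset _ _).trans (erase_subset _ _), ?_, by simp, by simp,
    ?_⟩
  · rw [card_erase_of_mem (mem_erase.2 ⟨hab.symm, hb⟩), card_erase_of_mem ha, hU]
    rfl
  · rw [insert_erase (mem_erase.2 ⟨hab.symm, hb⟩), insert_erase ha]

lemma vdmKernel_even_comm {ι : Type*} {e : ℕ} (he : Even e) (x : ι → R) (i j : ι) :
    vdmKernel 1 e x i j = vdmKernel 1 e x j i := by
  simp only [vdmKernel, Pi.one_apply, Int.cast_one, one_mul]
  rw [← neg_sub, he.neg_pow]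

lemma splitSum_collision_even {e : ℕ} (he : Even e) (he0 : e ≠ 0) {x : ι → R} {a b : ι}
    (hab : a ≠ b) (hx : x a = x b) {U : Finset ι} (ha : a ∉ U) (hb : b ∉ U)
    (hU : splitSum η c s (vdmKernel 1 e x) x U = 0) :
    splitSum η c s (vdmKernel 1 e x) x (insert a (insert b U)) = 0 := by
  have h1 : ∀ j, vdmKernel 1 e x b j = vdmKernel 1 e x a j := fun j => by
    simp [vdmKernel, hx]
  rw [splitSum_of_collision (vdmKernel_even_comm he x) hab (by simp [vdmKernel, hx, he0]) hx ha hb]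
  have h2 : ∀ S ∈ U.powerset, (∏ j ∈ S, vdmKernel 1 e x b j) * (∏ j ∈ U \ S, vdmKernel 1 e x a j) +
      (∏ j ∈ S, vdmKernel 1 e x a j) * ∏ j ∈ U \ S, vdmKernel 1 e x b j =
      2 * ∏ j ∈ U, vdmKernel 1 e x a j := by
    intro S hS
    simp only [h1]
    rw [mul_comm (∏ j ∈ S, _), prod_sdiff (mem_powerset.1 hS), two_mul]
  rw [sum_congr rfl fun S hS => by rw [h2 S hS], ← mul_sum]
  exact mul_eq_zero_of_right _ hU

lemma pairProd_swap {e : ℕ} {x : ι → R} {a b : ι} {S : Finset ι} (ha : a ∉ S) (hb : b ∉ S) :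
    pairProd (vdmKernel 1 e (fun i => x (Equiv.swap a b i))) S = pairProd (vdmKernel 1 e x) S := by
  have h : ∀ i ∈ S, Equiv.swap a b i = i := fun i hi =>
    Equiv.swap_apply_of_ne_of_ne (fun h => ha (h ▸ hi)) (fun h => hb (h ▸ hi))
  refine pairProd_congr fun i hi j hj _ => ?_
  simp [vdmKernel, h i hi, h j hj]

lemma splitSum_swap {e : ℕ} (he : Even e) (x : ι → R) {a b : ι} (hab : a ≠ b) {U : Finset ι}
    (ha : a ∉ U) (hb : b ∉ U) :
    splitSum η c s (vdmKernel 1 e fun i => x (Equiv.swap a b i)) (fun i => x (Equiv.swap a b i))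
      (insert a (insert b U)) = splitSum η c s (vdmKernel 1 e x) x (insert a (insert b U)) := by
  rw [splitSum_insert_insert _ _ hab ha hb, splitSum_insert_insert _ _ hab ha hb]
  refine sum_congr rfl fun S hS => ?_
  have haS : a ∉ S := fun h => ha (mem_powerset.1 hS h)
  have hbS : b ∉ S := fun h => hb (mem_powerset.1 hS h)
  have haT : a ∉ U \ S := by simp [ha]
  have hbT : b ∉ U \ S := by simp [hb]
  have hfix : ∀ {S : Finset ι}, a ∉ S → b ∉ S → ∀ i ∈ S, Equiv.swap a b i = i :=
    fun ha hb i hi =>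
      Equiv.swap_apply_of_ne_of_ne (fun h => ha (h ▸ hi)) (fun h => hb (h ▸ hi))
  have hs := vdmKernel_even_comm (R := R) (ι := ι) he
  have hsum : ∀ {S : Finset ι}, a ∉ S → b ∉ S → ∀ k : ℕ,
      ∑ i ∈ S, x (Equiv.swap a b i) ^ k = ∑ i ∈ S, x i ^ k := fun ha hb k =>
    sum_congr rfl fun i hi => by rw [hfix ha hb i hi]
  have hsum1 : ∀ {S : Finset ι}, a ∉ S → b ∉ S →
      ∑ i ∈ S, x (Equiv.swap a b i) = ∑ i ∈ S, x i := fun ha hb =>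
    sum_congr rfl fun i hi => by rw [hfix ha hb i hi]
  have hprod : ∀ {S : Finset ι}, a ∉ S → b ∉ S →
      ∏ j ∈ S, vdmKernel 1 e (fun i => x (Equiv.swap a b i)) a j = ∏ j ∈ S, vdmKernel 1 e x b j :=
    fun ha hb => prod_congr rfl fun i hi => by simp [vdmKernel, hfix ha hb i hi]
  have hprod' : ∀ {S : Finset ι}, a ∉ S → b ∉ S →
      ∏ j ∈ S, vdmKernel 1 e (fun i => x (Equiv.swap a b i)) b j = ∏ j ∈ S, vdmKernel 1 e x a j :=
    fun ha hb => prod_congr rfl fun i hi => by simp [vdmKernel, hfix ha hb i hi]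
  have hk : vdmKernel 1 e (fun i => x (Equiv.swap a b i)) a b = vdmKernel 1 e x a b := by
    rw [hs x a b]; simp [vdmKernel]
  have hP : ∀ {S : Finset ι}, a ∉ S → b ∉ S →
      pairProd (vdmKernel 1 e fun i => x (Equiv.swap a b i)) (insert a (insert b S)) =
      pairProd (vdmKernel 1 e x) (insert a (insert b S)) := by
    intro S ha hb
    have ha' : a ∉ insert b S := by simp [hab, ha]
    rw [pairProd_insert (hs _) ha', pairProd_insert (hs _) ha', pairProd_insert (hs _) hb,
      pairProd_insert (hs _) hb, prod_insert hb, prod_insert hb, hprod ha hb, hprod' ha hb, hk,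
      pairProd_swap ha hb]
    ring
  have hsum2 : ∀ {S : Finset ι}, a ∉ S → b ∉ S → ∀ k : ℕ,
      ∑ i ∈ insert a (insert b S), x (Equiv.swap a b i) ^ k =
        ∑ i ∈ insert a (insert b S), x i ^ k := by
    intro S ha hb k
    rw [sum_insert (by simp [hab, ha]), sum_insert hb, sum_insert (by simp [hab, ha]),
      sum_insert hb, hsum ha hb]
    simp only [Equiv.swap_apply_left, Equiv.swap_apply_right]
    ring
  have hsum3 : ∀ {S : Finset ι}, a ∉ S → b ∉ S →
      ∑ i ∈ insert a (insert b S), x (Equiv.swap a b i) =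
        ∑ i ∈ insert a (insert b S), x i := by
    intro S ha hb
    simpa using hsum2 ha hb 1
  rw [splitTerm_insert (hs _) hbS haT, splitTerm_insert (hs _) haS hbT,
    splitTerm_insert (hs _) hbS haT, splitTerm_insert (hs _) haS hbT]
  simp only [Equiv.swap_apply_left, Equiv.swap_apply_right, hprod haS hbS, hprod haT hbT,
    hprod' haS hbS, hprod' haT hbT, pairProd_swap haS hbS, pairProd_swap haT hbT, hsum haS hbS,
    hsum haT hbT, hsum1 haS hbS, hsum1 haT hbT, splitTerm, hP haS hbS, hP haT hbT, hsum2 haS hbS,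
    hsum2 haT hbT, hsum3 haS hbS, hsum3 haT hbT]
  ring

lemma sq_dvd_splitSum {e : ℕ} (he : Even e) (he0 : e ≠ 0) {a b : ι} (hab : a ≠ b) {U : Finset ι}
    (ha : a ∉ U) (hb : b ∉ U)
    (hU : splitSum η c s (vdmKernel 1 e (X : ι → MvPolynomial ι ℝ)) X U = 0) :
    (X a - X b) ^ 2 ∣
      splitSum η c s (vdmKernel 1 e (X : ι → MvPolynomial ι ℝ)) X (insert a (insert b U)) := by
  refine sq_dvd_of_swap hab (dvd_splitSum_of_collision ?_) ?_
  · exact splitSum_collision_even he he0 hab (by simp [hab.symm]) ha hb (splitSum_aeval hU _)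
  · have := map_splitSum (η := η) (c := c) (s := s) (rename (R := ℝ) (Equiv.swap a b)).toRingHom
      (vdmKernel 1 e X) X (insert a (insert b U))
    simp only [map_vdmKernel, AlgHom.toRingHom_eq_coe, RingHom.coe_coe, rename_X] at this
    rw [this, splitSum_swap he X hab ha hb]

theorem splitSum_two_eq_zero (n : ℕ) : ∀ U : Finset ι, #U = 2 * n →
    splitSum 1 0 2 (vdmKernel 1 2 (X : ι → MvPolynomial ι ℝ)) X U = 0 := by
  induction n with
  | zero => intro U hU; rw [card_eq_zero.1 hU, splitSum_empty]
  | succ n ih =>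
    intro U hU
    rcases Nat.eq_zero_or_pos n with rfl | hn
    · obtain ⟨a, b, hab, rfl⟩ := card_eq_two.1 hU
      rw [splitSum_pair_two _ _ hab]
      simp
    · refine eq_zero_of_pow_dvd (e := 2) (U := U)
        (splitSum_isHomogeneous (vdmKernel_isHomogeneous 1 2) (Or.inl rfl) hU) ?_ ?_
      · have h1 := choose_two_add (n + 1) (n + 1)
        rw [hU, show 2 * (n + 1) = n + 1 + (n + 1) by ring, h1]
        nlinarith
      · intro a ha b hb hab
        obtain ⟨V, -, hV, haV, hbV, rfl⟩ := exists_insert_insert (n := 2 * n) hU ha hb hab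
        exact sq_dvd_splitSum even_two two_ne_zero hab haV hbV (ih V hV)

theorem splitSum_four_eq_zero (n : ℕ) : ∀ U : Finset ι, #U = 2 * n →
    splitSum 4 6 1 (vdmKernel 1 4 (X : ι → MvPolynomial ι ℝ)) X U = 0 := by
  have he : Even 4 := by decide
  induction n with
  | zero => intro U hU; rw [card_eq_zero.1 hU, splitSum_empty]
  | succ n ih =>
    intro U hU
    obtain rfl | rfl | hn : n = 0 ∨ n = 1 ∨ 2 ≤ n := by omega
    · obtain ⟨a, b, hab, rfl⟩ := card_eq_two.1 hU
      rw [splitSum_pair_one (vdmKernel_even_comm he _) _ hab]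
      simp only [vdmKernel, Pi.one_apply]
      push_cast
      ring
    · obtain ⟨a, ha⟩ : U.Nonempty := card_pos.1 (by omega)
      obtain ⟨b, hb, hab⟩ := exists_mem_ne (by omega : 1 < #U) a
      obtain ⟨V, -, hV, haV, hbV, rfl⟩ := exists_insert_insert (n := 2) hU ha hb hab.symm
      obtain ⟨p, q, hpq, rfl⟩ := card_eq_two.1 hV
      simp only [mem_insert, mem_singleton, not_or] at haV hbV
      rw [splitSum_four_one (vdmKernel_even_comm he _) _ hab.symm haV.1 haV.2 hbV.1 hbV.2 hpq]
      simp only [vdmKernel, Pi.one_apply]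
      push_cast
      ring
    · refine eq_zero_of_pow_dvd (e := 2) (U := U)
        (splitSum_isHomogeneous (vdmKernel_isHomogeneous 1 4) (Or.inr (by norm_num)) hU) ?_ ?_
      · have h1 := choose_two_add (n + 1) (n + 1)
        have h2 : (n + 1).choose 2 * 2 = (n + 1) * n := by
          rw [Nat.choose_two_right]
          exact Nat.div_mul_cancel (by simpa using (Nat.even_mul_pred_self (n + 1)).two_dvd)
        rw [hU, show 2 * (n + 1) = n + 1 + (n + 1) by ring, h1]
        nlinarith
      · intro a ha b hb hab
        obtain ⟨V, -, hV, haV, hbV, rfl⟩ := exists_insert_insert (n := 2 * n) hU ha hb hab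
        exact sq_dvd_splitSum he (by norm_num) hab haV hbV (ih V hV)

end Vanishing

section Odd

open MvPolynomial

variable {ι R : Type*} [LinearOrder ι] [CommRing R] {η c s : ℕ}

/-- The sign of the difference `v - u`, as an integer. -/
noncomputable def ordSign (u v : ℝ) : ℤ := if u < v then 1 else if v < u then -1 else 0

lemma ordSign_comm (u v : ℝ) : ordSign u v = -ordSign v u := by
  unfold ordSign
  rcases lt_trichotomy u v with h | rfl | h
  · simp [h, h.not_gt]
  · simp
  · simp [h, h.not_gt]

/-- The kernel `±(x j - x i)` whose sign is dictated by an ordering `pos` of the indices. -/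
noncomputable def signedKernel (pos : ι → ℝ) (x : ι → R) : ι → ι → R :=
  vdmKernel (fun i j => ordSign (pos i) (pos j)) 1 x

lemma signedKernel_apply {ι : Type*} (pos : ι → ℝ) (x : ι → R) (i j : ι) :
    signedKernel pos x i j = ordSign (pos i) (pos j) * (x j - x i) := by
  simp [signedKernel, vdmKernel]

lemma signedKernel_comm {ι : Type*} (pos : ι → ℝ) (x : ι → R) (i j : ι) :
    signedKernel pos x i j = signedKernel pos x j i := by
  rw [signedKernel_apply, signedKernel_apply, ordSign_comm]
  push_cast
  ring

lemma prod_ite_neg_one {ι : Type*} (P : ι → Prop) [DecidablePred P] (S : Finset ι) :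
    ∏ j ∈ S, (if P j then (-1 : R) else 1) = (-1) ^ #(S.filter P) := by
  rw [prod_ite]
  simp

lemma pairProd_ite_neg_one (P : ι → Prop) [DecidablePred P] (S : Finset ι) :
    pairProd (fun i j => if P i ∧ P j then (-1 : R) else 1) S =
      (-1) ^ (#(S.filter P)).choose 2 := by
  induction S using Finset.induction_on with
  | empty => simp
  | insert a S ha ih =>
    rw [pairProd_insert (fun i j => by simp only [and_comm]) ha, ih]
    by_cases hP : P a
    · simp only [hP, true_and, prod_ite_neg_one]
      rw [filter_insert, if_pos hP, card_insert_of_notMem (by simp [ha]), choose_two_add]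
      simp [pow_add, mul_comm]
    · simp [hP, filter_insert]

/-- Reflection of the open interval `(u, v)`, fixing the other points. -/
noncomputable def reflectIoo (u v t : ℝ) : ℝ := if u < t ∧ t < v then u + v - t else t

lemma ordSign_reflectIoo {u v s t : ℝ} (huv : u < v) (hsu : s ≠ u) (hsv : s ≠ v) (htu : t ≠ u)
    (htv : t ≠ v) : ordSign s t = ordSign (reflectIoo u v s) (reflectIoo u v t) *
      if (u < s ∧ s < v) ∧ (u < t ∧ t < v) then -1 else 1 := by
  unfold ordSign reflectIoo
  grind

lemma reflectIoo_injective (u v : ℝ) : Function.Injective (reflectIoo u v) := by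
  intro s t h
  unfold reflectIoo at h
  grind

lemma neg_one_pow_choose_two {k l : ℕ} (h : Even (k + l)) :
    (-1 : R) ^ k * ((-1) ^ k.choose 2 * (-1) ^ l.choose 2) = (-1) ^ (k + l).choose 2 := by
  rw [choose_two_add, pow_add, pow_add, mul_comm]
  congr 1
  rcases Nat.even_or_odd k with hk | hk
  · rw [hk.neg_one_pow, (hk.mul_right l).neg_one_pow]
  · have hl : Odd l := by
      by_contra hl
      rw [Nat.not_odd_iff_even] at hl
      exact (Nat.not_even_iff_odd.2 (hk.add_even hl)) h
    rw [hk.neg_one_pow, (hk.mul hl).neg_one_pow]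

lemma splitSum_collision_odd {x : ι → R} {a b : ι} (hab : a ≠ b) (hx : x a = x b) {U : Finset ι}
    (ha : a ∉ U) (hb : b ∉ U) {pos : ι → ℝ} (hlt : pos a < pos b)
    (hpos : Set.InjOn pos (insert a (insert b U) : Finset ι))
    (hU : ∀ pos : ι → ℝ, Set.InjOn pos U → splitSum η c s (signedKernel pos x) x U = 0) :
    splitSum η c s (signedKernel pos x) x (insert a (insert b U)) = 0 := by
  have hne : ∀ j ∈ U, pos j ≠ pos a ∧ pos j ≠ pos b := by
    intro j hj
    have hj' : j ∈ (insert a (insert b U) : Finset ι) := by simp [hj]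
    constructor
    · intro h
      exact ha (hpos hj' (by simp) h ▸ hj)
    · intro h
      exact hb (hpos hj' (by simp) h ▸ hj)
  set P : ι → Prop := fun j => pos a < pos j ∧ pos j < pos b with hP
  have h1 : ∀ j ∈ U, signedKernel pos x b j =
      (if P j then -1 else 1) * signedKernel pos x a j := by
    intro j hj
    have h := hne j hj
    have h2 : ordSign (pos b) (pos j) = (if P j then -1 else 1) * ordSign (pos a) (pos j) := by
      simp only [hP, ordSign]
      grind
    rw [signedKernel_apply, signedKernel_apply, h2, hx]
    split_ifs <;> simp
  have hprod : ∀ S ⊆ U, ∏ j ∈ S, signedKernel pos x b j =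
      (-1) ^ #(S.filter P) * ∏ j ∈ S, signedKernel pos x a j := by
    intro S hS
    rw [prod_congr rfl fun j hj => h1 j (hS hj), prod_mul_distrib, prod_ite_neg_one]
  set pos' : ι → ℝ := fun j => reflectIoo (pos a) (pos b) (pos j) with hpos'
  have hpair : ∀ S ⊆ U, pairProd (signedKernel pos x) S =
      pairProd (signedKernel pos' x) S * (-1) ^ (#(S.filter P)).choose 2 := by
    intro S hS
    rw [← pairProd_ite_neg_one, ← pairProd_mul]
    refine pairProd_congr fun i hi j hj _ => ?_
    have hi := hne i (hS hi)
    have hj := hne j (hS hj)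
    rw [signedKernel_apply, signedKernel_apply,
      ordSign_reflectIoo hlt hi.1 hi.2 hj.1 hj.2]
    simp only [hP, hpos']
    split_ifs <;> simp
  rw [splitSum_of_collision (signedKernel_comm pos x) hab (by simp [signedKernel_apply, hx]) hx
    ha hb]
  have hcard : ∀ S ⊆ U, #(S.filter P) + #((U \ S).filter P) = #(U.filter P) := by
    intro S hS
    rw [← card_union_of_disjoint (disjoint_filter_filter disjoint_sdiff), ← filter_union,
      union_sdiff_of_subset hS]
  have hcoef : ∀ S ⊆ U, (∏ j ∈ S, signedKernel pos x b j) * (∏ j ∈ U \ S, signedKernel pos x a j) +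
      (∏ j ∈ S, signedKernel pos x a j) * ∏ j ∈ U \ S, signedKernel pos x b j =
      (∏ j ∈ U, signedKernel pos x a j) *
        ((-1) ^ #(S.filter P) + (-1) ^ #((U \ S).filter P)) := by
    intro S hS
    rw [hprod S hS, hprod _ sdiff_subset, ← prod_sdiff hS]
    ring
  rcases Nat.even_or_odd #(U.filter P) with hm | hm
  · have key : ∀ S ∈ U.powerset,
        ((∏ j ∈ S, signedKernel pos x b j) * (∏ j ∈ U \ S, signedKernel pos x a j) +
          (∏ j ∈ S, signedKernel pos x a j) * ∏ j ∈ U \ S, signedKernel pos x b j) *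
          splitTerm η c s (signedKernel pos x) x S (U \ S) =
        ((∏ j ∈ U, signedKernel pos x a j) * 2 * (-1) ^ (#(U.filter P)).choose 2) *
          splitTerm η c s (signedKernel pos' x) x S (U \ S) := by
      intro S hS
      have hS := mem_powerset.1 hS
      have hkl := hcard S hS
      have h3 := neg_one_pow_choose_two (R := R) (hkl ▸ hm)
      have h4 : (-1 : R) ^ #((U \ S).filter P) = (-1) ^ #(S.filter P) := by
        have : Even (#(S.filter P) + #((U \ S).filter P)) := hkl ▸ hm
        rw [Nat.even_add] at this
        rcases Nat.even_or_odd #(S.filter P) with h | h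
        · rw [h.neg_one_pow, (this.1 h).neg_one_pow]
        · rw [h.neg_one_pow, Odd.neg_one_pow]
          rw [← Nat.not_even_iff_odd] at h ⊢
          exact fun h' => h (this.2 h')
      rw [hcoef S hS, h4, ← hkl, ← h3, splitTerm, splitTerm, hpair S hS, hpair _ sdiff_subset]
      ring
    rw [sum_congr rfl key, ← mul_sum]
    refine mul_eq_zero_of_right _ (hU pos' fun i hi j hj hij => ?_)
    exact hpos (by simp [mem_coe.1 hi]) (by simp [mem_coe.1 hj]) (reflectIoo_injective _ _ hij)
  · refine sum_eq_zero fun S hS => ?_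
    have hS := mem_powerset.1 hS
    have hkl := hcard S hS
    have h4 : (-1 : R) ^ #(S.filter P) + (-1) ^ #((U \ S).filter P) = 0 := by
      have : Odd (#(S.filter P) + #((U \ S).filter P)) := hkl ▸ hm
      rw [Nat.odd_add] at this
      rcases Nat.even_or_odd #((U \ S).filter P) with h | h
      · rw [h.neg_one_pow, (this.2 h).neg_one_pow]; ring
      · rw [h.neg_one_pow, Even.neg_one_pow]
        · ring
        · exact Nat.not_odd_iff_even.1 fun h' => Nat.not_even_iff_odd.2 h (this.1 h')
    rw [hcoef S hS, h4, mul_zero, zero_mul]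

lemma exists_eq_insert_min {n : ℕ} {U : Finset ι} (hU : #U = n + 1) {pos : ι → ℝ}
    (hpos : Set.InjOn pos U) :
    ∃ a, ∃ V : Finset ι, #V = n ∧ a ∉ V ∧ U = insert a V ∧ ∀ j ∈ V, pos a < pos j := by
  obtain ⟨a, ha, hmin⟩ := exists_min_image U pos (card_pos.1 (by omega))
  refine ⟨a, U.erase a, by rw [card_erase_of_mem ha, hU]; rfl, by simp, (insert_erase ha).symm,
    fun j hj => ?_⟩
  have hj' := mem_erase.1 hj
  exact lt_of_le_of_ne (hmin j hj'.2) fun h => hj'.1 (hpos ha hj'.2 h).symm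

lemma dvd_splitSum_signed {n : ℕ} {U : Finset ι} (hU : #U = n + 2) {pos : ι → ℝ}
    (hpos : Set.InjOn pos U)
    (ih : ∀ V : Finset ι, #V = n → ∀ pos : ι → ℝ, Set.InjOn pos V →
      splitSum η c s (signedKernel pos (X : ι → MvPolynomial ι ℝ)) X V = 0)
    {a b : ι} (ha : a ∈ U) (hb : b ∈ U) (hlt : pos a < pos b) :
    X a - X b ∣ splitSum η c s (signedKernel pos (X : ι → MvPolynomial ι ℝ)) X U := by
  have hab : a ≠ b := fun h => hlt.ne (h ▸ rfl)
  obtain ⟨V, -, hV, haV, hbV, rfl⟩ := exists_insert_insert hU ha hb hab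
  refine dvd_splitSum_of_collision ?_
  exact splitSum_collision_odd hab (by simp [hab.symm]) haV hbV hlt hpos
    fun pos' hpos' => splitSum_aeval (ih V hV pos' hpos') _

theorem splitSum_signed_eq_zero (n : ℕ) : ∀ U : Finset ι, #U = 2 * n → ∀ pos : ι → ℝ,
    Set.InjOn pos U → splitSum 1 24 2 (signedKernel pos (X : ι → MvPolynomial ι ℝ)) X U = 0 := by
  induction n with
  | zero => intro U hU pos _; rw [card_eq_zero.1 hU, splitSum_empty]
  | succ n ih =>
    intro U hU pos hpos
    obtain rfl | rfl | hn : n = 0 ∨ n = 1 ∨ 2 ≤ n := by omega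
    · obtain ⟨a, b, hab, rfl⟩ := card_eq_two.1 hU
      rw [splitSum_pair_two _ _ hab]
      simp
    · obtain ⟨a, V, hV, -, rfl, haV⟩ := exists_eq_insert_min (n := 3) hU hpos
      obtain ⟨b, V, hV', -, rfl, hbV⟩ := exists_eq_insert_min (n := 2) hV
        (hpos.mono (by simp))
      obtain ⟨p, V, hV'', -, rfl, hpV⟩ := exists_eq_insert_min (n := 1) hV'
        (hpos.mono fun i hi => by simp at hi ⊢; tauto)
      obtain ⟨q, rfl⟩ := card_eq_one.1 hV''
      simp only [mem_insert, mem_singleton, forall_eq_or_imp, forall_eq] at haV hbV hpV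
      have hne : ∀ {i j : ι}, pos i < pos j → i ≠ j := fun h e => h.ne (e ▸ rfl)
      rw [splitSum_four_two (signedKernel_comm pos _) _ (hne haV.1) (hne haV.2.1) (hne haV.2.2)
        (hne hbV.1) (hne hbV.2) (hne hpV)]
      simp only [signedKernel_apply, ordSign, haV, hbV, hpV, if_true]
      push_cast
      ring
    · refine eq_zero_of_pow_dvd (e := 1) (U := U)
        (splitSum_isHomogeneous (vdmKernel_isHomogeneous _ 1) (Or.inr (by norm_num)) hU) ?_ ?_
      · have h1 := choose_two_add (n + 1) (n + 1)
        rw [hU, show 2 * (n + 1) = n + 1 + (n + 1) by ring, h1]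
        nlinarith
      · intro a ha b hb hab
        rw [pow_one]
        rcases lt_or_gt_of_ne (fun h => hab (hpos ha hb h)) with hlt | hlt
        · exact dvd_splitSum_signed (n := 2 * n) hU hpos ih ha hb hlt
        · rw [← neg_sub, neg_dvd]
          exact dvd_splitSum_signed (n := 2 * n) hU hpos ih hb ha hlt

end Odd

section RealPoints

variable {ι : Type*} [LinearOrder ι]

/-- The parameters `(η, c, s)` of `splitSum` attached to `β ∈ {1, 2, 4}`. -/
def IsSplitParam (β : ℝ) (η c s : ℕ) : Prop :=
  (β = 1 ∧ η = 1 ∧ c = 24 ∧ s = 2) ∨ (β = 2 ∧ η = 1 ∧ c = 0 ∧ s = 2) ∨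
    (β = 4 ∧ η = 4 ∧ c = 6 ∧ s = 1)

lemma exists_injOn_of_monotone (x : ι → ℝ) (U : Finset ι) :
    ∃ pos : ι → ℝ, Set.InjOn pos U ∧ ∀ i ∈ U, ∀ j ∈ U, x i < x j → pos i < pos j := by
  set r : ι → ℝ := fun i => #(U.filter fun j => toLex (x j, j) < toLex (x i, i)) with hr
  have hlt : ∀ i ∈ U, ∀ j ∈ U, toLex (x i, i) < toLex (x j, j) → r i < r j := by
    intro i hi j hj hij
    refine Nat.cast_lt.2 (card_lt_card ?_)
    refine (ssubset_iff_of_subset fun k hk => ?_).2 ⟨i, by simp [hi, hij], by simp⟩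
    simp only [mem_filter] at hk ⊢
    exact ⟨hk.1, hk.2.trans hij⟩
  refine ⟨r, fun i hi j hj hij => ?_, fun i hi j hj hij => hlt i hi j hj ?_⟩
  · rcases lt_trichotomy (toLex (x i, i)) (toLex (x j, j)) with h | h | h
    · exact absurd hij (hlt i hi j hj h).ne
    · exact congrArg (fun p => (ofLex p).2) h
    · exact absurd hij (hlt j hj i hi h).ne'
  · exact Prod.Lex.toLex_lt_toLex.2 (Or.inl hij)

lemma splitSum_congr {R : Type*} [CommRing R] {η c s : ℕ} {h k : ι → ι → R} {x : ι → R}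
    {U : Finset ι} (hk : ∀ i ∈ U, ∀ j ∈ U, i < j → h i j = k i j) :
    splitSum η c s h x U = splitSum η c s k x U := by
  refine sum_congr rfl fun S hS => ?_
  have hS := mem_powerset.1 hS
  rw [splitTerm, splitTerm, pairProd_congr fun i hi j hj => hk i (hS hi) j (hS hj),
    pairProd_congr fun i hi j hj => hk i (sdiff_subset hi) j (sdiff_subset hj)]

theorem splitSum_abs_eq_zero {β : ℝ} {η c s : ℕ} (hp : IsSplitParam β η c s) {n : ℕ}
    (x : ι → ℝ) {U : Finset ι} (hU : #U = 2 * n) :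
    splitSum η c s (fun i j => |x j - x i| ^ β) x U = 0 := by
  rcases hp with ⟨rfl, rfl, rfl, rfl⟩ | ⟨rfl, rfl, rfl, rfl⟩ | ⟨rfl, rfl, rfl, rfl⟩
  · obtain ⟨pos, hinj, hpos⟩ := exists_injOn_of_monotone x U
    rw [← splitSum_aeval (splitSum_signed_eq_zero n U hU pos hinj) x]
    refine splitSum_congr fun i hi j hj _ => ?_
    have := signedKernel_apply pos x i j
    rw [signedKernel] at this
    rw [this, Real.rpow_one]
    rcases lt_trichotomy (x i) (x j) with h | h | h
    · rw [abs_of_pos (sub_pos.2 h)]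
      simp [ordSign, hpos i hi j hj h]
    · simp [h]
    · rw [abs_of_neg (sub_neg.2 h)]
      simp [ordSign, hpos j hj i hi h, (hpos j hj i hi h).not_gt]
  · rw [← splitSum_aeval (splitSum_two_eq_zero n U hU) x]
    refine splitSum_congr fun i hi j hj _ => ?_
    rw [show (2 : ℝ) = (2 : ℕ) by norm_num, Real.rpow_natCast]
    simp [vdmKernel]
  · rw [← splitSum_aeval (splitSum_four_eq_zero n U hU) x]
    refine splitSum_congr fun i hi j hj _ => ?_
    rw [show (4 : ℝ) = (4 : ℕ) by norm_num, Real.rpow_natCast]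
    simp [vdmKernel, (by decide : Even 4).pow_abs]

end RealPoints

section JacobiMeasure

variable {α δ : ℝ}

/-- The one-point density of the Jacobi ensemble. -/
noncomputable def jacDensity (α δ t : ℝ) : ℝ := t ^ α * (1 - t) ^ (δ / 2)

/-- The one-point measure of the Jacobi ensemble. -/
noncomputable def jacMeasure (α δ : ℝ) : Measure ℝ :=
  (volume.restrict (Set.Icc 0 1)).withDensity fun t => ENNReal.ofReal (jacDensity α δ t)

lemma jacDensity_nonneg {t : ℝ} (ht : t ∈ Set.Icc (0 : ℝ) 1) : 0 ≤ jacDensity α δ t :=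
  mul_nonneg (Real.rpow_nonneg ht.1 _) (Real.rpow_nonneg (sub_nonneg.2 ht.2) _)

lemma jacDensity_pos {t : ℝ} (ht : t ∈ Set.Ioo (0 : ℝ) 1) : 0 < jacDensity α δ t :=
  mul_pos (Real.rpow_pos_of_pos ht.1 _) (Real.rpow_pos_of_pos (sub_pos.2 ht.2) _)

lemma measurable_jacDensity : Measurable (jacDensity α δ) := by
  unfold jacDensity
  fun_prop

lemma integrable_jacDensity (hα : -1 < α) (hδ : -2 < δ) :
    Integrable (jacDensity α δ) (volume.restrict (Set.Icc 0 1)) := by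
  have h1 : 0 < α + 1 := by linarith
  have h2 : 0 < δ / 2 + 1 := by linarith
  have hintegral : Integrable (ProbabilityTheory.betaPDFReal (α + 1) (δ / 2 + 1)) := by
    refine ⟨(ProbabilityTheory.stronglyMeasurable_betaPDFReal _ _).aestronglyMeasurable, ?_⟩
    rw [hasFiniteIntegral_iff_ofReal]
    · exact (ProbabilityTheory.lintegral_betaPDF_eq_one h1 h2).trans_lt ENNReal.one_lt_top
    · refine ae_of_all _ fun x => ?_
      by_cases hx : 0 < x ∧ x < 1
      · exact (ProbabilityTheory.betaPDFReal_pos hx.1 hx.2 h1 h2).le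
      · simp [ProbabilityTheory.betaPDFReal, hx]
  change IntegrableOn _ _ _
  rw [integrableOn_Icc_iff_integrableOn_Ioo]
  refine IntegrableOn.congr_fun
    (f := fun t => ProbabilityTheory.beta (α + 1) (δ / 2 + 1) *
      ProbabilityTheory.betaPDFReal (α + 1) (δ / 2 + 1) t)
    (hintegral.const_mul _).integrableOn (fun t ht => ?_) measurableSet_Ioo
  have h0 := (ProbabilityTheory.beta_pos h1 h2).ne'
  simp only [ProbabilityTheory.betaPDFReal, jacDensity, ht.1, ht.2, and_self, if_true,
    add_sub_cancel_right]
  rw [mul_assoc (1 / _), one_div, mul_inv_cancel_left₀ h0]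

instance [Fact (-1 < α)] [Fact (-2 < δ)] : IsFiniteMeasure (jacMeasure α δ) := by
  have h := (integrable_jacDensity (Fact.out : -1 < α) (Fact.out : -2 < δ)).lintegral_lt_top
  exact isFiniteMeasure_withDensity h.ne

variable {ι : Type*} [Fintype ι]

/-- The product of the one-point measures. -/
noncomputable def jacPi (α δ : ℝ) (ι : Type*) [Fintype ι] : Measure (ι → ℝ) :=
  Measure.pi fun _ : ι => jacMeasure α δ

instance [Fact (-1 < α)] [Fact (-2 < δ)] : IsFiniteMeasure (jacPi α δ ι) := by
  unfold jacPi; infer_instance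

lemma restrict_Icc_pi : (volume : Measure (ι → ℝ)).restrict (Set.Icc 0 1) =
    Measure.pi fun _ => volume.restrict (Set.Icc 0 1) := by
  rw [← Measure.restrict_pi_pi, Set.pi_univ_Icc, volume_pi]
  rfl

lemma jacPi_eq_withDensity [Fact (-1 < α)] [Fact (-2 < δ)] :
    jacPi α δ ι = ((volume : Measure (ι → ℝ)).restrict (Set.Icc 0 1)).withDensity
      fun T => ENNReal.ofReal (∏ i, jacDensity α δ (T i)) := by
  have hintegral := integrable_jacDensity (Fact.out : -1 < α) (Fact.out : -2 < δ)
  refine Measure.pi_eq fun s hs => ?_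
  have hnn : ∀ᵐ t ∂(volume : Measure ℝ).restrict (Set.Icc 0 1), 0 ≤ jacDensity α δ t :=
    ae_restrict_of_forall_mem measurableSet_Icc fun t ht => jacDensity_nonneg ht
  have hnn' : ∀ᵐ T ∂(volume : Measure (ι → ℝ)).restrict (Set.Icc 0 1),
      0 ≤ ∏ i, jacDensity α δ (T i) :=
    ae_restrict_of_forall_mem measurableSet_Icc fun T hT =>
      prod_nonneg fun i _ => jacDensity_nonneg ⟨hT.1 i, hT.2 i⟩
  rw [withDensity_apply _ (MeasurableSet.univ_pi hs), ← ofReal_integral_eq_lintegral_ofReal,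
    restrict_Icc_pi, Measure.restrict_pi_pi,
    integral_fintype_prod_eq_prod (fun _ => jacDensity α δ), ENNReal.ofReal_prod_of_nonneg]
  · refine prod_congr rfl fun i _ => ?_
    rw [jacMeasure, withDensity_apply _ (hs i), ← ofReal_integral_eq_lintegral_ofReal]
    · exact hintegral.restrict
    · exact ae_restrict_of_ae hnn
  · intro i _
    exact integral_nonneg_of_ae (ae_restrict_of_ae hnn)
  · rw [restrict_Icc_pi]
    exact (Integrable.fintype_prod (f := fun _ => jacDensity α δ) fun _ => hintegral).restrict
  · exact ae_restrict_of_ae hnn'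

lemma integral_jacPi [Fact (-1 < α)] [Fact (-2 < δ)] (g : (ι → ℝ) → ℝ) :
    ∫ T, g T ∂jacPi α δ ι = ∫ T in Set.Icc (0 : ι → ℝ) 1, (∏ i, jacDensity α δ (T i)) * g T := by
  rw [jacPi_eq_withDensity, integral_withDensity_eq_integral_toReal_smul]
  · refine setIntegral_congr_fun measurableSet_Icc fun T hT => ?_
    simp only [smul_eq_mul]
    rw [ENNReal.toReal_ofReal (prod_nonneg fun i _ => jacDensity_nonneg ⟨hT.1 i, hT.2 i⟩)]
  · have := measurable_jacDensity (α := α) (δ := δ)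
    fun_prop
  · exact ae_of_all _ fun _ => ENNReal.ofReal_lt_top

lemma ae_jacPi_mem_Icc [Fact (-1 < α)] [Fact (-2 < δ)] :
    ∀ᵐ T ∂jacPi α δ ι, T ∈ Set.Icc (0 : ι → ℝ) 1 := by
  rw [jacPi_eq_withDensity]
  exact (withDensity_absolutelyContinuous _ _).ae_le (ae_restrict_mem measurableSet_Icc)

lemma integrable_jacPi [Fact (-1 < α)] [Fact (-2 < δ)] {E : Type*} [NormedAddCommGroup E]
    [SecondCountableTopology E] {g : (ι → ℝ) → E} (hg : Continuous g) :
    Integrable g (jacPi α δ ι) := by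
  obtain ⟨C, hC⟩ := (isCompact_Icc (a := (0 : ι → ℝ)) (b := 1)).exists_bound_of_continuousOn
    hg.continuousOn
  exact Integrable.of_bound hg.aestronglyMeasurable C
    (ae_jacPi_mem_Icc.mono fun T hT => hC T hT)

end JacobiMeasure

section Moments

variable {ι : Type*} [Fintype ι] {β α δ z w : ℝ}

/-- The exponential weight of the joint moment generating function. -/
noncomputable def jacExp (z w : ℝ) (T : ι → ℝ) : ℝ :=
  Real.exp (∑ j, (-(z * T j) - w * T j * (1 - T j)))

/-- The unnormalized expectation of `f` in the deformed Jacobi ensemble. -/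
noncomputable def jacMoment (β α δ z w : ℝ) (n : ℕ) (f : (Fin n → ℝ) → ℝ) : ℝ :=
  ∫ T, f T * (jacExp z w T * vand β T) ∂jacPi α δ (Fin n)

/-- The power sum of degree `k`. -/
def powSum (k : ℕ) (T : ι → ℝ) : ℝ := ∑ j, T j ^ k

@[fun_prop]
lemma continuous_powSum (k : ℕ) : Continuous (powSum k : (ι → ℝ) → ℝ) := by
  unfold powSum
  fun_prop

@[fun_prop]
lemma continuous_jacExp : Continuous (jacExp z w : (ι → ℝ) → ℝ) := by
  unfold jacExp
  fun_prop

lemma continuous_vand (hβ : 0 ≤ β) {n : ℕ} : Continuous (vand β : (Fin n → ℝ) → ℝ) := by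
  unfold vand
  refine continuous_finsetProd _ fun j _ => continuous_finsetProd _ fun k _ => ?_
  exact Continuous.rpow_const (by fun_prop) fun _ => Or.inr hβ

lemma vand_eq_pairProd {n : ℕ} (T : Fin n → ℝ) :
    vand β T = pairProd (fun i j => |T j - T i| ^ β) univ := by
  unfold vand pairProd
  refine prod_congr rfl fun i _ => ?_
  rw [← prod_filter]
  exact prod_congr (by ext; simp) fun _ _ => rfl

lemma pairProd_eq_vand {N m : ℕ} (T : Fin N → ℝ) {S : Finset (Fin N)} (hS : #S = m) :
    pairProd (fun i j => |T j - T i| ^ β) S = vand β fun k => T (S.orderEmbOfFin hS k) := by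
  rw [vand_eq_pairProd]
  unfold pairProd
  have h : S = univ.map (S.orderEmbOfFin hS).toEmbedding := (map_orderEmbOfFin_univ S hS).symm
  conv_lhs => rw [h]
  simp only [prod_map]
  simp

lemma sum_eq_sum_orderEmbOfFin {M : Type*} [AddCommMonoid M] {N m : ℕ} (f : Fin N → M)
    {S : Finset (Fin N)} (hS : #S = m) : ∑ i ∈ S, f i = ∑ k, f (S.orderEmbOfFin hS k) := by
  have h : S = univ.map (S.orderEmbOfFin hS).toEmbedding := (map_orderEmbOfFin_univ S hS).symm
  conv_lhs => rw [h]
  simp only [sum_map]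
  simp

variable [Fact (-1 < α)] [Fact (-2 < δ)]

lemma integral_jacPi_split {N m k : ℕ} {S : Finset (Fin N)} (hS : #S = m) (hS' : #Sᶜ = k)
    (g : (Fin m → ℝ) × (Fin k → ℝ) → ℝ) :
    ∫ T, g (fun i => T (S.orderEmbOfFin hS i), fun i => T (Sᶜ.orderEmbOfFin hS' i))
      ∂jacPi α δ (Fin N) = ∫ p, g p ∂(jacPi α δ (Fin m)).prod (jacPi α δ (Fin k)) := by
  have h1 := measurePreserving_piCongrLeft (fun _ : Fin N => jacMeasure α δ)
    (finSumEquivOfFinset hS hS')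
  have h2 := measurePreserving_sumPiEquivProdPi fun _ : Fin m ⊕ Fin k => jacMeasure α δ
  have h3 : MeasurePreserving ((MeasurableEquiv.piCongrLeft (fun _ => ℝ)
      (finSumEquivOfFinset hS hS')).symm.trans (MeasurableEquiv.sumPiEquivProdPi fun _ => ℝ))
      (jacPi α δ (Fin N)) ((jacPi α δ (Fin m)).prod (jacPi α δ (Fin k))) := h2.comp h1.symm
  exact h3.integral_comp' g

/-- The integral of a splitting term over the two groups of variables. -/
noncomputable def splitIntegral (η c s : ℕ) (β α δ z w : ℝ) (m k : ℕ) : ℝ :=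
  ∫ p, jacExp z w p.1 * vand β p.1 * (jacExp z w p.2 * vand β p.2) *
      splitWeight η c s ((m : ℤ) - k) (powSum 1 p.1 - powSum 1 p.2)
        (powSum 2 p.1 - powSum 2 p.2) (powSum 3 p.1 - powSum 3 p.2)
    ∂(jacPi α δ (Fin m)).prod (jacPi α δ (Fin k))

lemma integral_splitTerm {η c s N m k : ℕ} {S : Finset (Fin N)} (hS : #S = m) (hS' : #Sᶜ = k) :
    ∫ T, jacExp z w T * splitTerm η c s (fun i j => |T j - T i| ^ β) T S (univ \ S)
      ∂jacPi α δ (Fin N) = splitIntegral η c s β α δ z w m k := by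
  rw [splitIntegral, ← integral_jacPi_split hS hS']
  congr 1
  ext T
  have h1 : jacExp z w T = jacExp z w (fun i => T (S.orderEmbOfFin hS i)) *
      jacExp z w (fun i => T (Sᶜ.orderEmbOfFin hS' i)) := by
    unfold jacExp
    rw [← Real.exp_add, ← sum_eq_sum_orderEmbOfFin (fun i => -(z * T i) - w * T i * (1 - T i)),
      ← sum_eq_sum_orderEmbOfFin (fun i => -(z * T i) - w * T i * (1 - T i)), sum_add_sum_compl]
  have h2 : ∀ k : ℕ, ∑ i ∈ S, T i ^ k = powSum k fun i => T (S.orderEmbOfFin hS i) := fun k =>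
    sum_eq_sum_orderEmbOfFin (fun i => T i ^ k) hS
  have h3 : ∀ k : ℕ, ∑ i ∈ Sᶜ, T i ^ k = powSum k fun i => T (Sᶜ.orderEmbOfFin hS' i) := fun k =>
    sum_eq_sum_orderEmbOfFin (fun i => T i ^ k) hS'
  have h2' := h2 1
  have h3' := h3 1
  simp only [pow_one] at h2' h3'
  rw [splitTerm, ← compl_eq_univ_sdiff, hS, hS', pairProd_eq_vand T hS, pairProd_eq_vand T hS', h1,
    h2, h3, h2, h3, h2', h3']
  ring

lemma continuous_splitTerm {η c s N : ℕ} (hβ : 0 ≤ β) (S S' : Finset (Fin N)) :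
    Continuous fun T : Fin N → ℝ => splitTerm η c s (fun i j => |T j - T i| ^ β) T S S' := by
  have h1 : ∀ S : Finset (Fin N),
      Continuous fun T : Fin N → ℝ => pairProd (fun i j => |T j - T i| ^ β) S := by
    intro S
    unfold pairProd
    refine continuous_finsetProd _ fun i _ => continuous_finsetProd _ fun j _ => ?_
    split_ifs
    · exact Continuous.rpow_const (by fun_prop) fun _ => Or.inr hβ
    · fun_prop
  unfold splitTerm splitWeight
  refine ((h1 S).mul (h1 S')).mul ?_
  split_ifs <;> fun_prop

theorem sum_splitIntegral_eq_zero {η c s : ℕ} (hp : IsSplitParam β η c s) (n : ℕ) :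
    ∑ m ∈ range (2 * n + 1),
      ((2 * n).choose m : ℝ) * splitIntegral η c s β α δ z w m (2 * n - m) = 0 := by
  have hβ : 0 ≤ β := by
    rcases hp with h | h | h <;> rw [h.1] <;> norm_num
  have h1 : ∑ S ∈ (univ : Finset (Fin (2 * n))).powerset,
      ∫ T, jacExp z w T * splitTerm η c s (fun i j => |T j - T i| ^ β) T S (univ \ S)
        ∂jacPi α δ (Fin (2 * n)) = 0 := by
    rw [← integral_finsetSum]
    · simp only [← mul_sum]
      refine integral_eq_zero_of_ae (ae_of_all _ fun T => ?_)
      exact mul_eq_zero_of_right _ (splitSum_abs_eq_zero hp (n := n) T (by simp))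
    · exact fun S _ => integrable_jacPi (continuous_jacExp.mul (continuous_splitTerm hβ _ _))
  have h2 : ∀ S ∈ (univ : Finset (Fin (2 * n))).powerset,
      ∫ T, jacExp z w T * splitTerm η c s (fun i j => |T j - T i| ^ β) T S (univ \ S)
        ∂jacPi α δ (Fin (2 * n)) = splitIntegral η c s β α δ z w #S (2 * n - #S) :=
    fun S _ => integral_splitTerm rfl (by rw [card_compl, Fintype.card_fin])
  rw [sum_congr rfl h2, sum_powerset_apply_card
    (fun m => splitIntegral η c s β α δ z w m (2 * n - m))] at h1
  simpa using h1

lemma splitIntegral_of_ne {α δ : ℝ} {η c s m k : ℕ} (h0 : (m : ℤ) - k ≠ 0)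
    (h1 : (m : ℤ) - k ≠ -(2 * s)) :
    splitIntegral η c s β α δ z w m k = 0 := by
  simp [splitIntegral, splitWeight, h0, h1]

lemma integral_prod_jacMoment {m k : ℕ} (f : (Fin m → ℝ) → ℝ) (g : (Fin k → ℝ) → ℝ) :
    ∫ p, f p.1 * (jacExp z w p.1 * vand β p.1) * (g p.2 * (jacExp z w p.2 * vand β p.2))
      ∂(jacPi α δ (Fin m)).prod (jacPi α δ (Fin k)) =
      jacMoment β α δ z w m f * jacMoment β α δ z w k g :=
  integral_prod_mul (fun T => f T * (jacExp z w T * vand β T))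
    fun T => g T * (jacExp z w T * vand β T)

lemma splitIntegral_shift {η c s m k : ℕ} (hs : s ≠ 0) (h : (m : ℤ) - k = -(2 * s)) :
    splitIntegral η c s β α δ z w m k =
      -c * (jacMoment β α δ z w m 1 * jacMoment β α δ z w k 1) := by
  have h0 : (m : ℤ) - k ≠ 0 := by omega
  rw [← integral_prod_jacMoment, ← integral_const_mul, splitIntegral]
  congr 1
  ext p
  rw [splitWeight, if_neg h0, if_pos h]
  simp only [Pi.one_apply]
  ring

lemma integrable_prod_jacMoment (hβ : 0 ≤ β) {m k : ℕ} {f : (Fin m → ℝ) → ℝ}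
    {g : (Fin k → ℝ) → ℝ} (hf : Continuous f) (hg : Continuous g) :
    Integrable (fun p : (Fin m → ℝ) × (Fin k → ℝ) =>
      f p.1 * (jacExp z w p.1 * vand β p.1) * (g p.2 * (jacExp z w p.2 * vand β p.2)))
      ((jacPi α δ (Fin m)).prod (jacPi α δ (Fin k))) :=
  (integrable_jacPi (hf.mul (continuous_jacExp.mul (continuous_vand hβ)))).mul_prod
    (integrable_jacPi (hg.mul (continuous_jacExp.mul (continuous_vand hβ))))

lemma splitIntegral_diag {η c s n : ℕ} (hβ : 0 ≤ β) :
    splitIntegral η c s β α δ z w n n =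
      2 * (η * (jacMoment β α δ z w n 1 * jacMoment β α δ z w n (powSum 1 ^ 4) -
        4 * (jacMoment β α δ z w n (powSum 1) * jacMoment β α δ z w n (powSum 1 ^ 3)) +
        3 * jacMoment β α δ z w n (powSum 1 ^ 2) ^ 2) +
      3 * (jacMoment β α δ z w n 1 * jacMoment β α δ z w n (powSum 2 ^ 2) -
        jacMoment β α δ z w n (powSum 2) ^ 2) -
      4 * (jacMoment β α δ z w n 1 * jacMoment β α δ z w n (powSum 1 * powSum 3) -
        jacMoment β α δ z w n (powSum 1) * jacMoment β α δ z w n (powSum 3))) := by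
  set μ := (jacPi α δ (Fin n)).prod (jacPi α δ (Fin n))
  set J : ((Fin n → ℝ) → ℝ) → ((Fin n → ℝ) → ℝ) → (Fin n → ℝ) × (Fin n → ℝ) → ℝ := fun f g p =>
    f p.1 * (jacExp z w p.1 * vand β p.1) * (g p.2 * (jacExp z w p.2 * vand β p.2)) with hJ
  set m := jacMoment β α δ z w n with hm
  set f : Fin 12 → (Fin n → ℝ) → ℝ := ![powSum 1 ^ 4, powSum 1 ^ 3, powSum 1 ^ 2, powSum 1, 1,
    powSum 2 ^ 2, powSum 2, 1, powSum 1 * powSum 3, powSum 1, powSum 3, 1] with hf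
  set g : Fin 12 → (Fin n → ℝ) → ℝ := ![1, powSum 1, powSum 1 ^ 2, powSum 1 ^ 3, powSum 1 ^ 4,
    1, powSum 2, powSum 2 ^ 2, 1, powSum 3, powSum 1, powSum 1 * powSum 3] with hg
  set a : Fin 12 → ℝ := ![η, -4 * η, 6 * η, -4 * η, η, 3, -6, 3, -4, 4, 4, -4] with ha
  have hcont : ∀ i, Continuous (f i) ∧ Continuous (g i) := by
    have h (k : ℕ) : Continuous (powSum k : (Fin n → ℝ) → ℝ) := continuous_powSum k
    have h1 : Continuous (1 : (Fin n → ℝ) → ℝ) := continuous_const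
    intro i
    fin_cases i <;> constructor <;> first
      | exact h _
      | exact h1
      | exact (h _).pow _
      | exact (h _).mul (h _)
  have hsum : ∫ p, ∑ i, a i * J (f i) (g i) p ∂μ = ∑ i, a i * (m (f i) * m (g i)) := by
    rw [integral_finsetSum]
    · refine sum_congr rfl fun i _ => ?_
      rw [integral_const_mul]
      exact congrArg _ (integral_prod_jacMoment (f i) (g i))
    · exact fun i _ => (integrable_prod_jacMoment hβ (hcont i).1 (hcont i).2).const_mul _
  have hintegral : splitIntegral η c s β α δ z w n n = ∫ p, ∑ i, a i * J (f i) (g i) p ∂μ := by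
    rw [splitIntegral]
    congr 1
    ext p
    rw [splitWeight, if_pos (by ring)]
    simp only [hJ, ha, hf, hg, Fin.sum_univ_succ, Fin.sum_univ_zero, Matrix.cons_val_zero,
      Matrix.cons_val_succ, Pi.pow_apply, Pi.mul_apply, Pi.one_apply]
    ring
  rw [hintegral, hsum]
  simp only [ha, hf, hg, Fin.sum_univ_succ, Fin.sum_univ_zero, Matrix.cons_val_zero,
    Matrix.cons_val_succ]
  ring

/-- The bilinear relation between the moments in dimensions `n` and `n ± s`. -/
theorem jacMoment_bilinear {η c s n : ℕ} (hp : IsSplitParam β η c s) (hs : c = 0 ∨ s ≤ n) :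
    ((2 * n).choose n : ℝ) *
      (2 * (η * (jacMoment β α δ z w n 1 * jacMoment β α δ z w n (powSum 1 ^ 4) -
        4 * (jacMoment β α δ z w n (powSum 1) * jacMoment β α δ z w n (powSum 1 ^ 3)) +
        3 * jacMoment β α δ z w n (powSum 1 ^ 2) ^ 2) +
      3 * (jacMoment β α δ z w n 1 * jacMoment β α δ z w n (powSum 2 ^ 2) -
        jacMoment β α δ z w n (powSum 2) ^ 2) -
      4 * (jacMoment β α δ z w n 1 * jacMoment β α δ z w n (powSum 1 * powSum 3) -
        jacMoment β α δ z w n (powSum 1) * jacMoment β α δ z w n (powSum 3)))) =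
    ((2 * n).choose (n - s) : ℝ) * (c * (jacMoment β α δ z w (n - s) 1 *
      jacMoment β α δ z w (n + s) 1)) := by
  have hβ : 0 ≤ β := by
    rcases hp with h | h | h <;> rw [h.1] <;> norm_num
  have hs0 : s ≠ 0 := by
    rcases hp with h | h | h <;> rw [h.2.2.2] <;> norm_num
  have h := sum_splitIntegral_eq_zero (α := α) (δ := δ) (z := z) (w := w) hp n
  rcases hs with rfl | hs
  · rw [sum_eq_single n (fun k hk hne => ?_) (fun hk => absurd (mem_range.2 (by omega)) hk),
      show 2 * n - n = n by omega, splitIntegral_diag hβ] at h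
    · rw [h]
      simp
    · rw [mem_range] at hk
      have h0 : (k : ℤ) - (2 * n - k : ℕ) ≠ 0 := by omega
      simp [splitIntegral, splitWeight, h0]
  rw [sum_eq_add (n - s) n (by omega)] at h
  · rw [show 2 * n - (n - s) = n + s by omega, show 2 * n - n = n by omega, splitIntegral_diag hβ,
      splitIntegral_shift hs0 (by omega)] at h
    linarith
  · intro k hk hne
    rw [mem_range] at hk
    rw [splitIntegral_of_ne (by omega) (by omega), mul_zero]
  · intro hk
    exact absurd (mem_range.2 (by omega)) hk
  · intro hk
    exact absurd (mem_range.2 (by omega)) hk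

end Moments

section Smoothness

variable {ι : Type*} [Fintype ι] {β α δ z w : ℝ}

lemma jacExp_eq (z w : ℝ) (T : ι → ℝ) :
    jacExp z w T = Real.exp (-z * powSum 1 T - w * (powSum 1 T - powSum 2 T)) := by
  unfold jacExp powSum
  rw [← sum_sub_distrib, mul_sum, mul_sum, ← sum_sub_distrib]
  congr 1
  exact sum_congr rfl fun i _ => by ring

lemma hasFDerivAt_jacExp (T : ι → ℝ) (p : ℝ × ℝ) :
    HasFDerivAt (fun p : ℝ × ℝ => jacExp p.1 p.2 T)
      (-(jacExp p.1 p.2 T * powSum 1 T) • ContinuousLinearMap.fst ℝ ℝ ℝ -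
        (jacExp p.1 p.2 T * (powSum 1 T - powSum 2 T)) • ContinuousLinearMap.snd ℝ ℝ ℝ) p := by
  have h : HasFDerivAt
      (fun p : ℝ × ℝ => -p.1 * powSum 1 T - p.2 * (powSum 1 T - powSum 2 T)) _ p :=
    ((hasFDerivAt_fst (𝕜 := ℝ) (p := p)).neg.mul_const (powSum 1 T)).sub
      ((hasFDerivAt_snd (𝕜 := ℝ) (p := p)).mul_const (powSum 1 T - powSum 2 T))
  simp only [jacExp_eq]
  refine h.exp.congr_fderiv ?_
  ext <;> simp

variable [Fact (-1 < α)] [Fact (-2 < δ)]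

set_option maxHeartbeats 1000000 in
lemma hasFDerivAt_jacMoment (hβ : 0 ≤ β) {n : ℕ} {f : (Fin n → ℝ) → ℝ} (hf : Continuous f)
    (p : ℝ × ℝ) :
    HasFDerivAt (fun p : ℝ × ℝ => jacMoment β α δ p.1 p.2 n f)
      ((-jacMoment β α δ p.1 p.2 n (f * powSum 1)) • ContinuousLinearMap.fst ℝ ℝ ℝ -
        jacMoment β α δ p.1 p.2 n (f * (powSum 1 - powSum 2)) •
          ContinuousLinearMap.snd ℝ ℝ ℝ) p := by
  have hv := continuous_vand hβ (n := n)
  have h1 : Continuous (powSum 1 : (Fin n → ℝ) → ℝ) := continuous_powSum 1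
  have h2 : Continuous (powSum 2 : (Fin n → ℝ) → ℝ) := continuous_powSum 2
  obtain ⟨F', hF'⟩ : ∃ F' : ℝ × ℝ → (Fin n → ℝ) → (ℝ × ℝ →L[ℝ] ℝ), F' = fun p T =>
      (-(f T * powSum 1 T * (jacExp p.1 p.2 T * vand β T))) • ContinuousLinearMap.fst ℝ ℝ ℝ -
        (f T * (powSum 1 T - powSum 2 T) * (jacExp p.1 p.2 T * vand β T)) •
          ContinuousLinearMap.snd ℝ ℝ ℝ := ⟨_, rfl⟩
  have hE : Continuous fun q : (ℝ × ℝ) × (Fin n → ℝ) => jacExp q.1.1 q.1.2 q.2 := by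
    unfold jacExp
    fun_prop
  have hcont : Continuous fun q : (ℝ × ℝ) × (Fin n → ℝ) => F' q.1 q.2 := by
    simp only [hF']
    exact ((((hf.comp continuous_snd).mul (h1.comp continuous_snd)).mul
      (hE.mul (hv.comp continuous_snd))).neg.smul continuous_const).sub
      ((((hf.comp continuous_snd).mul ((h1.comp continuous_snd).sub (h2.comp continuous_snd))).mul
      (hE.mul (hv.comp continuous_snd))).smul continuous_const)
  obtain ⟨C, hC⟩ := ((isCompact_closedBall p 1).prod
    (isCompact_Icc (a := (0 : Fin n → ℝ)) (b := 1))).exists_bound_of_continuousOn hcont.continuousOn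
  have hd (T : Fin n → ℝ) (q : ℝ × ℝ) :
      HasFDerivAt (fun p : ℝ × ℝ => f T * (jacExp p.1 p.2 T * vand β T)) (F' q T) q := by
    refine (((hasFDerivAt_jacExp T q).mul_const (vand β T)).const_mul (f T)).congr_fderiv ?_
    rw [hF']
    ext <;> simp <;> ring
  have hI1 := (integrable_jacPi (α := α) (δ := δ)
    ((hf.mul h1).mul ((continuous_jacExp (z := p.1) (w := p.2)).mul hv))).neg
  have hI2 := integrable_jacPi (α := α) (δ := δ)
    ((hf.mul (h1.sub h2)).mul ((continuous_jacExp (z := p.1) (w := p.2)).mul hv))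
  have hintegral : ∫ T, F' p T ∂jacPi α δ (Fin n) =
      (-jacMoment β α δ p.1 p.2 n (f * powSum 1)) • ContinuousLinearMap.fst ℝ ℝ ℝ -
        jacMoment β α δ p.1 p.2 n (f * (powSum 1 - powSum 2)) •
          ContinuousLinearMap.snd ℝ ℝ ℝ := by
    rw [hF', jacMoment, jacMoment, ← integral_neg]
    exact (integral_sub (hI1.smul_const _) (hI2.smul_const _)).trans
      (congrArg₂ (· - ·) (integral_smul_const _ _) (integral_smul_const _ _))
  rw [← hintegral]
  exact hasFDerivAt_integral_of_dominated_of_fderiv_le (𝕜 := ℝ) (μ := jacPi α δ (Fin n))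
    (F := fun p T => f T * (jacExp p.1 p.2 T * vand β T)) (F' := F') (x₀ := p)
    (bound := fun _ => C) (Metric.closedBall_mem_nhds p one_pos)
    (Eventually.of_forall fun q =>
      (hf.mul (continuous_jacExp.mul hv)).aestronglyMeasurable)
    (integrable_jacPi (hf.mul (continuous_jacExp.mul hv)))
    (hcont.comp (Continuous.prodMk_right p)).aestronglyMeasurable
    (ae_jacPi_mem_Icc.mono fun T hT q hq => hC (q, T) ⟨hq, hT⟩) (integrable_const C)
    (ae_of_all _ fun T q _ => hd T q)

lemma contDiff_jacMoment (hβ : 0 ≤ β) {n : ℕ} (k : ℕ) : ∀ {f : (Fin n → ℝ) → ℝ},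
    Continuous f → ContDiff ℝ k fun p : ℝ × ℝ => jacMoment β α δ p.1 p.2 n f := by
  have h1 : Continuous (powSum 1 : (Fin n → ℝ) → ℝ) := continuous_powSum 1
  have h2 : Continuous (powSum 2 : (Fin n → ℝ) → ℝ) := continuous_powSum 2
  induction k with
  | zero =>
    intro f hf
    exact contDiff_zero.2 (continuous_iff_continuousAt.2 fun p =>
      (hasFDerivAt_jacMoment hβ hf p).continuousAt)
  | succ k ih =>
    intro f hf
    rw [Nat.cast_succ, contDiff_succ_iff_fderiv]
    refine ⟨fun p => (hasFDerivAt_jacMoment hβ hf p).differentiableAt, by simp, ?_⟩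
    have h : fderiv ℝ (fun p : ℝ × ℝ => jacMoment β α δ p.1 p.2 n f) = _ :=
      funext fun p => (hasFDerivAt_jacMoment hβ hf p).fderiv
    rw [h]
    exact ((ih (hf.mul h1)).neg.smul contDiff_const).sub ((ih (hf.mul (h1.sub h2))).smul
      contDiff_const)

lemma hasDerivAt_jacMoment_left (hβ : 0 ≤ β) {n : ℕ} {f : (Fin n → ℝ) → ℝ} (hf : Continuous f)
    (z w : ℝ) : HasDerivAt (fun z => jacMoment β α δ z w n f)
      (-jacMoment β α δ z w n (f * powSum 1)) z := by
  have h := (hasFDerivAt_jacMoment (α := α) (δ := δ) hβ hf (z, w)).comp_hasDerivAt z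
    ((hasDerivAt_id z).prodMk (hasDerivAt_const z w))
  exact h.congr_deriv (by simp)

lemma hasDerivAt_jacMoment_right (hβ : 0 ≤ β) {n : ℕ} {f : (Fin n → ℝ) → ℝ} (hf : Continuous f)
    (z w : ℝ) : HasDerivAt (fun w => jacMoment β α δ z w n f)
      (-jacMoment β α δ z w n (f * (powSum 1 - powSum 2))) w := by
  have h := (hasFDerivAt_jacMoment (α := α) (δ := δ) hβ hf (z, w)).comp_hasDerivAt w
    ((hasDerivAt_const w z).prodMk (hasDerivAt_id w))
  exact h.congr_deriv (by simp)

lemma vand_nonneg {n : ℕ} (T : Fin n → ℝ) : 0 ≤ vand β T :=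
  prod_nonneg fun _ _ => prod_nonneg fun _ _ => Real.rpow_nonneg (abs_nonneg _) _

lemma vand_pos {n : ℕ} {T : Fin n → ℝ} (hT : Function.Injective T) : 0 < vand β T :=
  prod_pos fun _ _ => prod_pos fun _ hk => Real.rpow_pos_of_pos
    (abs_pos.2 (sub_ne_zero.2 fun h => (mem_Ioi.1 hk).ne' (hT h))) _

lemma jacMoment_one_pos (hβ : 0 ≤ β) (n : ℕ) : 0 < jacMoment β α δ z w n 1 := by
  unfold jacMoment
  have hcont : Continuous fun T : Fin n → ℝ => jacExp z w T * vand β T :=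
    continuous_jacExp.mul (continuous_vand hβ)
  have hintegral := integrable_jacPi (α := α) (δ := δ) hcont
  have hnn : (0 : (Fin n → ℝ) → ℝ) ≤ fun T => jacExp z w T * vand β T :=
    fun T => mul_nonneg (Real.exp_nonneg _) (vand_nonneg T)
  simp only [Pi.one_apply, one_mul]
  rw [integral_pos_iff_support_of_nonneg hnn hintegral]
  set U : Set (Fin n → ℝ) := Set.univ.pi fun _ => Set.Ioo 0 1 with hU
  have hUo : IsOpen U := isOpen_set_pi Set.finite_univ fun _ _ => isOpen_Ioo
  set V := Function.support fun T : Fin n → ℝ => jacExp z w T * vand β T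
  have hV : IsOpen (U ∩ V) := hUo.inter hcont.isOpen_support
  have hne : (U ∩ V).Nonempty := by
    have hn : (0 : ℝ) < n + 1 := by positivity
    refine ⟨fun i => ((i : ℕ) + 1) / (n + 1), fun i _ => ⟨by positivity, ?_⟩, ?_⟩
    · rw [div_lt_one hn]
      have : ((i : ℕ) : ℝ) < n := Nat.cast_lt.2 i.2
      linarith
    · refine (mul_pos (Real.exp_pos _) (vand_pos fun i j hij => ?_)).ne'
      rw [div_left_inj' hn.ne', add_left_inj, Nat.cast_inj] at hij
      exact Fin.ext hij
  have hsub : U ∩ V ⊆ Set.Icc 0 1 := fun T hT =>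
    ⟨fun i => (hT.1 i trivial).1.le, fun i => (hT.1 i trivial).2.le⟩
  refine lt_of_lt_of_le ?_ (measure_mono (Set.inter_subset_right : U ∩ V ⊆ V))
  rw [pos_iff_ne_zero, jacPi_eq_withDensity, Ne, withDensity_apply_eq_zero']
  · refine (lt_of_lt_of_le (hV.measure_pos volume hne) ?_).ne'
    rw [Measure.restrict_apply₀']
    · refine measure_mono fun T hT => ⟨⟨?_, hT⟩, hsub hT⟩
      exact (ENNReal.ofReal_pos.2 (prod_pos fun i _ => jacDensity_pos (hT.1 i trivial))).ne'
    · exact measurableSet_Icc.nullMeasurableSet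
  · have := measurable_jacDensity (α := α) (δ := δ)
    exact Measurable.aemeasurable (by fun_prop)

end Smoothness

section IntegrationByParts

variable {α δ : ℝ}

lemma ofReal_jacDensity_ae_eq : ∀ᵐ t ∂(volume : Measure ℝ).restrict (Set.Icc 0 1),
    (ENNReal.ofReal (jacDensity α δ t)).toReal = jacDensity α δ t :=
  ae_restrict_of_forall_mem measurableSet_Icc fun _ ht =>
    ENNReal.toReal_ofReal (jacDensity_nonneg ht)

lemma integral_jacMeasure (g : ℝ → ℝ) :
    ∫ t, g t ∂jacMeasure α δ = ∫ t in Set.Icc 0 1, jacDensity α δ t * g t := by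
  rw [jacMeasure, integral_withDensity_eq_integral_toReal_smul
    measurable_jacDensity.ennreal_ofReal (ae_of_all _ fun _ => ENNReal.ofReal_lt_top)]
  exact integral_congr_ae (ofReal_jacDensity_ae_eq.mono fun t ht => by
    simp only [smul_eq_mul]; rw [ht])

lemma integrable_jacMeasure_iff {g : ℝ → ℝ} : Integrable g (jacMeasure α δ) ↔
    IntegrableOn (fun t => jacDensity α δ t * g t) (Set.Icc 0 1) := by
  rw [jacMeasure, integrable_withDensity_iff_integrable_smul'
    measurable_jacDensity.ennreal_ofReal (ae_of_all _ fun _ => ENNReal.ofReal_lt_top)]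
  exact integrable_congr (ofReal_jacDensity_ae_eq.mono fun t ht => by
    simp only [smul_eq_mul]; rw [ht])

lemma integral_jacMeasure_byParts (hα : -1 < α) (hδ : -2 < δ) {g g' : ℝ → ℝ} {s : Set ℝ}
    (hs : s.Countable) (hc : Continuous g)
    (hd : ∀ t ∈ Set.Ioo (0 : ℝ) 1 \ s, HasDerivAt g (g' t) t)
    (hi : Integrable (fun t => ((α + 1) * (1 - t) - (δ / 2 + 1) * t) * g t +
      t * (1 - t) * g' t) (jacMeasure α δ)) :
    ∫ t, (((α + 1) * (1 - t) - (δ / 2 + 1) * t) * g t + t * (1 - t) * g' t)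
      ∂jacMeasure α δ = 0 := by
  have h1 : 0 < α + 1 := by linarith
  have h2 : 0 < δ / 2 + 1 := by linarith
  rw [integrable_jacMeasure_iff] at hi
  rw [integral_jacMeasure, integral_Icc_eq_integral_Ioc,
    ← intervalIntegral.integral_of_le zero_le_one,
    integral_eq_of_hasDerivAt_off_countable_of_le
      (fun t => t ^ (α + 1) * (1 - t) ^ (δ / 2 + 1) * g t) _ zero_le_one hs ?_ ?_ ?_]
  · simp [Real.zero_rpow h1.ne', Real.zero_rpow h2.ne']
  · refine ContinuousOn.mul (Continuous.continuousOn ?_) hc.continuousOn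
    exact (continuous_id.rpow_const fun _ => Or.inr h1.le).mul
      ((continuous_const.sub continuous_id).rpow_const fun _ => Or.inr h2.le)
  · intro t ht
    have ht0 : 0 < t := ht.1.1
    have ht1 : 0 < 1 - t := sub_pos.2 ht.1.2
    have e1 := (hasDerivAt_id t).rpow_const (p := α + 1) (Or.inl ht0.ne')
    have e2 := ((hasDerivAt_const t (1 : ℝ)).sub (hasDerivAt_id t)).rpow_const
      (p := δ / 2 + 1) (Or.inl ht1.ne')
    refine ((e1.mul e2).mul (hd t ht)).congr_deriv ?_
    simp only [id, Pi.mul_apply, Pi.sub_apply, jacDensity, add_sub_cancel_right,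
      Real.rpow_add_one ht0.ne', Real.rpow_add_one ht1.ne']
    ring
  · rw [intervalIntegrable_iff_integrableOn_Icc_of_le zero_le_one]
    exact hi

lemma integral_jacPi_byParts [Fact (-1 < α)] [Fact (-2 < δ)] {n : ℕ} (j : Fin n)
    {h h' : (Fin n → ℝ) → ℝ} (hc : Continuous h)
    (hd : ∀ T, (∀ i, i ≠ j → T i ≠ T j) →
      HasDerivAt (fun t => h (Function.update T j t)) (h' T) (T j))
    (hi : Integrable (fun T => ((α + 1) * (1 - T j) - (δ / 2 + 1) * T j) * h T +
      T j * (1 - T j) * h' T) (jacPi α δ (Fin n))) :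
    ∫ T, (((α + 1) * (1 - T j) - (δ / 2 + 1) * T j) * h T + T j * (1 - T j) * h' T)
      ∂jacPi α δ (Fin n) = 0 := by
  obtain ⟨m, rfl⟩ : ∃ m, n = m + 1 := ⟨n - 1, by have := j.pos; omega⟩
  have hmp := (measurePreserving_piFinSuccAbove (fun _ : Fin (m + 1) => jacMeasure α δ) j).symm
  have hi' := (hmp.integrable_comp_emb (MeasurableEquiv.measurableEmbedding _)).2 hi
  have he := hmp.integral_comp' (fun T => ((α + 1) * (1 - T j) - (δ / 2 + 1) * T j) * h T +
      T j * (1 - T j) * h' T)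
  have hcoe (p : ℝ × (Fin m → ℝ)) :
      (MeasurableEquiv.piFinSuccAbove (fun _ : Fin (m + 1) => ℝ) j).symm p =
        j.insertNth p.1 p.2 := rfl
  simp only [Function.comp_def, hcoe, Fin.insertNth_apply_same] at hi' he
  change _ = ∫ T, _ ∂jacPi α δ (Fin (m + 1)) at he
  rw [← he, integral_prod_symm _ hi']
  refine integral_eq_zero_of_ae (hi'.prod_left_ae.mono fun y hy => ?_)
  refine integral_jacMeasure_byParts Fact.out Fact.out (s := Set.range y)
    (g := fun t => h (j.insertNth t y)) (g' := fun t => h' (j.insertNth t y))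
    (Set.countable_range y) (hc.comp ?_) (fun t ht => ?_) hy
  · exact continuous_id.finInsertNth (A := fun _ => ℝ) j (continuous_const (y := y))
  · have := hd (j.insertNth t y) fun i hij => ?_
    · simpa using this
    · obtain ⟨k, rfl⟩ := Fin.exists_succAbove_eq hij
      simp only [Fin.insertNth_apply_succAbove, Fin.insertNth_apply_same]
      exact fun hk => ht.2 ⟨k, hk⟩

end IntegrationByParts

section LoopEquation

variable {n : ℕ} {β α δ z w : ℝ}

lemma HasDerivAt.prod_of_mul {ι : Type*} {s : Finset ι} {f : ι → ℝ → ℝ} {l : ι → ℝ} {x : ℝ}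
    (hf : ∀ i ∈ s, HasDerivAt (f i) (f i x * l i) x) :
    HasDerivAt (fun t => ∏ i ∈ s, f i t) ((∏ i ∈ s, f i x) * ∑ i ∈ s, l i) x := by
  classical
  refine (HasDerivAt.fun_finsetProd hf).congr_deriv ?_
  rw [mul_sum]
  refine sum_congr rfl fun i hi => ?_
  rw [smul_eq_mul, ← mul_assoc, prod_erase_mul _ _ hi]

lemma hasDerivAt_update_apply (T : Fin n → ℝ) (j k : Fin n) (t : ℝ) :
    HasDerivAt (fun t => Function.update T j t k) ((Pi.single j 1 : Fin n → ℝ) k) t :=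
  hasDerivAt_pi.1 (hasDerivAt_update T j t) k

/-- The logarithmic derivative of the interaction factor in the `j`-th coordinate. -/
noncomputable def vandLogDeriv (β : ℝ) (j : Fin n) (T : Fin n → ℝ) : ℝ :=
  ∑ i, ∑ k ∈ Ioi i,
    β * (((Pi.single j 1 : Fin n → ℝ) k - (Pi.single j 1 : Fin n → ℝ) i) / (T k - T i))

lemma hasDerivAt_vand_update {j : Fin n} {T : Fin n → ℝ} (hT : ∀ i, i ≠ j → T i ≠ T j) :
    HasDerivAt (fun t => vand β (Function.update T j t)) (vand β T * vandLogDeriv β j T)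
      (T j) := by
  have h : HasDerivAt (fun t => vand β (Function.update T j t))
      (vand β (Function.update T j (T j)) * vandLogDeriv β j T) (T j) := by
    refine HasDerivAt.prod_of_mul fun i _ => HasDerivAt.prod_of_mul fun k hk => ?_
    have hik : i < k := mem_Ioi.1 hk
    rw [Function.update_eq_self]
    have hd := (hasDerivAt_update_apply T j k (T j)).sub (hasDerivAt_update_apply T j i (T j))
    by_cases h0 : T k - T i = 0
    · have hk : k ≠ j := by
        rintro rfl
        exact hT i hik.ne (sub_eq_zero.1 h0).symm
      have hi : i ≠ j := by
        rintro rfl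
        exact hT k hik.ne' (sub_eq_zero.1 h0)
      simp only [Function.update_of_ne hk, Function.update_of_ne hi, h0, div_zero, mul_zero]
      exact hasDerivAt_const _ _
    · have h1 : Function.update T j (T j) k - Function.update T j (T j) i ≠ 0 := by
        rwa [Function.update_eq_self]
      have hd' := (HasDerivAt.comp (T j) (hasDerivAt_abs h1) hd).rpow_const (p := β)
        (Or.inl (abs_ne_zero.2 h1))
      refine hd'.congr_deriv ?_
      simp only [Function.comp_apply, Pi.sub_apply, Function.update_eq_self]
      rw [Real.rpow_sub_one (abs_ne_zero.2 h0)]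
      rcases lt_or_gt_of_ne h0 with h | h
      · simp only [sign_neg h, abs_of_neg h]
        field_simp
        simp
        ring
      · simp only [sign_pos h, abs_of_pos h]
        field_simp
        simp
  rwa [Function.update_eq_self] at h

lemma hasDerivAt_jacExp_update (j : Fin n) (T : Fin n → ℝ) :
    HasDerivAt (fun t => jacExp z w (Function.update T j t))
      (jacExp z w T * (-z - w + 2 * w * T j)) (T j) := by
  have h (k : Fin n) : HasDerivAt (fun t => -(z * Function.update T j t k) -
      w * Function.update T j t k * (1 - Function.update T j t k))
      ((Pi.single j 1 : Fin n → ℝ) k * (-z - w + 2 * w * T k)) (T j) := by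
    have hu := hasDerivAt_update_apply T j k (T j)
    refine ((hu.const_mul z).neg.sub ((hu.const_mul w).mul (hu.const_sub 1))).congr_deriv ?_
    simp only [Function.update_eq_self]
    ring
  refine (HasDerivAt.fun_sum fun k (_ : k ∈ univ) => h k).exp.congr_deriv ?_
  simp [jacExp, Pi.single_apply]

lemma sum_sum_Ioi_add (g : Fin n → ℝ) :
    ∑ i, ∑ k ∈ Ioi i, (g i + g k) = (n - 1) * ∑ i, g i := by
  have h : ∑ i, ∑ k ∈ Ioi i, g k = ∑ k, ∑ i ∈ Iio k, g k := sum_comm' (by simp)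
  simp only [sum_add_distrib]
  rw [h, ← sum_add_distrib, mul_sum]
  refine sum_congr rfl fun i _ => ?_
  have hi : (n : ℝ) = ((n - 1 - i : ℕ) : ℝ) + (i : ℕ) + 1 := by
    have := i.2
    norm_cast
    omega
  simp only [sum_const, Fin.card_Ioi, Fin.card_Iio, nsmul_eq_mul]
  rw [hi]
  ring

lemma vand_eq_zero (hβ : β ≠ 0) {T : Fin n → ℝ} {i k : Fin n} (hik : i < k) (h : T k - T i = 0) :
    vand β T = 0 :=
  prod_eq_zero (mem_univ i) (prod_eq_zero (mem_Ioi.2 hik) (by simp [h, Real.zero_rpow hβ]))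

lemma sum_mul_vandLogDeriv (hβ : β ≠ 0) (T : Fin n → ℝ) :
    (∑ j, T j * (1 - T j) * vandLogDeriv β j T) * vand β T =
      β * ((n - 1) * (n / 2 - powSum 1 T)) * vand β T := by
  have h1 : ∑ j, T j * (1 - T j) * vandLogDeriv β j T = ∑ i, ∑ k ∈ Ioi i,
      β * ((T k * (1 - T k) - T i * (1 - T i)) / (T k - T i)) := by
    simp only [vandLogDeriv, mul_sum]
    rw [sum_comm]
    refine sum_congr rfl fun i _ => ?_
    rw [sum_comm]
    refine sum_congr rfl fun k _ => ?_
    have (j : Fin n) : T j * (1 - T j) * (β * (((Pi.single j 1 : Fin n → ℝ) k -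
        (Pi.single j 1 : Fin n → ℝ) i) / (T k - T i))) =
        (if k = j then β * (T j * (1 - T j) / (T k - T i)) else 0) -
          if i = j then β * (T j * (1 - T j) / (T k - T i)) else 0 := by
      rw [Pi.single_apply, Pi.single_apply]
      split_ifs <;> ring
    simp only [this, sum_sub_distrib, sum_ite_eq, mem_univ, if_true]
    ring
  have h2 : (n - 1) * (n / 2 - powSum 1 T) = ∑ i, ∑ k ∈ Ioi i, ((1 / 2 - T i) + (1 / 2 - T k)) := by
    rw [sum_sum_Ioi_add fun i => 1 / 2 - T i]
    simp only [powSum, pow_one, sum_sub_distrib, sum_const, card_univ,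
    Fintype.card_fin,
      nsmul_eq_mul]
    ring
  rw [h1, h2, mul_sum, sum_mul, sum_mul]
  refine sum_congr rfl fun i _ => ?_
  rw [mul_sum, sum_mul, sum_mul]
  refine sum_congr rfl fun k hk => ?_
  by_cases h0 : T k - T i = 0
  · rw [vand_eq_zero hβ (mem_Ioi.1 hk) h0]
    simp
  · congr 1
    field_simp
    ring

lemma abs_vand_div_le_one (hβ : 1 ≤ β) {T : Fin n → ℝ} (hT : T ∈ Set.Icc (0 : Fin n → ℝ) 1)
    {i k : Fin n} (hik : i < k) : |vand β T / (T k - T i)| ≤ 1 := by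
  have hle (i k : Fin n) : |T k - T i| ≤ 1 := by
    have h1 := hT.1 i; have h2 := hT.2 i; have h3 := hT.1 k; have h4 := hT.2 k
    simp only [Pi.zero_apply, Pi.one_apply] at h1 h2 h3 h4
    exact abs_le.2 ⟨by linarith, by linarith⟩
  have h0 (i k : Fin n) : 0 ≤ |T k - T i| ^ β := Real.rpow_nonneg (abs_nonneg _) _
  have h1 (i k : Fin n) : |T k - T i| ^ β ≤ 1 :=
    Real.rpow_le_one (abs_nonneg _) (hle i k) (by linarith)
  have key : vand β T ≤ |T k - T i| ^ β := by
    unfold vand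
    rw [← mul_prod_erase _ _ (mem_univ i), ← mul_prod_erase _ _ (mem_Ioi.2 hik), mul_assoc]
    refine mul_le_of_le_one_right (h0 i k) (mul_le_one₀ ?_ ?_ ?_)
    · exact prod_le_one (fun _ _ => h0 _ _) fun _ _ => h1 _ _
    · exact prod_nonneg fun _ _ => prod_nonneg fun _ _ => h0 _ _
    · exact prod_le_one (fun _ _ => prod_nonneg fun _ _ => h0 _ _)
        fun _ _ => prod_le_one (fun _ _ => h0 _ _) fun _ _ => h1 _ _
  rw [abs_div, abs_of_nonneg (vand_nonneg T)]
  refine div_le_one_of_le₀ (key.trans ?_) (abs_nonneg _)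
  exact Real.rpow_le_self_of_le_one (abs_nonneg _) (hle i k) hβ

variable [Fact (-1 < α)] [Fact (-2 < δ)]

lemma integrable_mul_vand_div (hβ : 1 ≤ β) {f : (Fin n → ℝ) → ℝ} (hf : Continuous f)
    {i k : Fin n} (hik : i < k) :
    Integrable (fun T => f T * (vand β T / (T k - T i))) (jacPi α δ (Fin n)) := by
  have hv := (continuous_vand (n := n) (zero_le_one.trans hβ)).measurable
  obtain ⟨C, hC⟩ := (isCompact_Icc (a := (0 : Fin n → ℝ)) (b := 1)).exists_bound_of_continuousOn
    hf.continuousOn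
  have hfm := hf.measurable
  refine Integrable.of_bound (Measurable.aestronglyMeasurable (by fun_prop)) C
    (ae_jacPi_mem_Icc.mono fun T hT => ?_)
  rw [norm_mul]
  exact (mul_le_of_le_one_right (norm_nonneg _) (abs_vand_div_le_one hβ hT hik)).trans (hC T hT)

lemma integrable_mul_vandLogDeriv (hβ : 1 ≤ β) {f : (Fin n → ℝ) → ℝ} (hf : Continuous f)
    (j : Fin n) :
    Integrable (fun T => f T * (vand β T * vandLogDeriv β j T)) (jacPi α δ (Fin n)) := by
  simp only [vandLogDeriv, mul_sum]
  refine integrable_finsetSum _ fun i _ => integrable_finsetSum _ fun k hk => ?_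
  refine (integrable_mul_vand_div hβ (hf.mul (continuous_const (y := β *
    ((Pi.single j 1 : Fin n → ℝ) k - (Pi.single j 1 : Fin n → ℝ) i)))) (mem_Ioi.1 hk)).congr
    (ae_of_all _ fun T => ?_)
  simp only [Pi.mul_apply]
  ring

end LoopEquation

section LoopMoments

variable {n : ℕ} {β α δ z w : ℝ} [Fact (-1 < α)] [Fact (-2 < δ)]

lemma integrable_mul_jacWeight (hβ : 0 ≤ β) {f : (Fin n → ℝ) → ℝ} (hf : Continuous f) :
    Integrable (fun T => f T * (jacExp z w T * vand β T)) (jacPi α δ (Fin n)) :=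
  integrable_jacPi (hf.mul (continuous_jacExp.mul (continuous_vand hβ)))

lemma integral_loop (hβ : 1 ≤ β) :
    ∫ T, (((α + 1) * n + β * (n * (n - 1) / 2)) +
      (-z - w - (α + δ / 2 + 2 + β * (n - 1))) * powSum 1 T + (3 * w + z) * powSum 2 T -
        2 * w * powSum 3 T) * (jacExp z w T * vand β T) ∂jacPi α δ (Fin n) = 0 := by
  have hβ0 : 0 ≤ β := zero_le_one.trans hβ
  have hv := continuous_vand hβ0 (n := n)
  set h' : Fin n → (Fin n → ℝ) → ℝ := fun j T =>
    jacExp z w T * vand β T * (-z - w + 2 * w * T j) +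
      jacExp z w T * (vand β T * vandLogDeriv β j T)
    with hh'
  have hd (j : Fin n) (T : Fin n → ℝ) (hT : ∀ i, i ≠ j → T i ≠ T j) :
      HasDerivAt (fun t => (jacExp z w * vand β : (Fin n → ℝ) → ℝ) (Function.update T j t))
        (h' j T) (T j) := by
    refine ((hasDerivAt_jacExp_update j T).mul (hasDerivAt_vand_update hT)).congr_deriv ?_
    simp only [Function.update_eq_self, hh']
    ring
  have hi (j : Fin n) : Integrable (fun T => ((α + 1) * (1 - T j) - (δ / 2 + 1) * T j) *
      (jacExp z w * vand β : (Fin n → ℝ) → ℝ) T + T j * (1 - T j) * h' j T)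
      (jacPi α δ (Fin n)) := by
    have e1 := integrable_jacPi (α := α) (δ := δ) (g := fun T : Fin n → ℝ =>
      ((α + 1) * (1 - T j) - (δ / 2 + 1) * T j + T j * (1 - T j) * (-z - w + 2 * w * T j)) *
        (jacExp z w T * vand β T)) (by fun_prop)
    have e2 := integrable_mul_vandLogDeriv (α := α) (δ := δ) hβ
      (f := fun T : Fin n → ℝ => T j * (1 - T j) * jacExp z w T) (by fun_prop) j
    refine (e1.add e2).congr (ae_of_all _ fun T => ?_)
    simp only [Pi.add_apply, Pi.mul_apply, hh']
    ring
  have hsum : ∑ j, ∫ T, (((α + 1) * (1 - T j) - (δ / 2 + 1) * T j) *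
      (jacExp z w * vand β : (Fin n → ℝ) → ℝ) T + T j * (1 - T j) * h' j T)
      ∂jacPi α δ (Fin n) = 0 :=
    sum_eq_zero fun j _ => integral_jacPi_byParts j (continuous_jacExp.mul hv) (hd j) (hi j)
  rw [← integral_finsetSum _ fun j _ => hi j] at hsum
  rw [← hsum]
  congr 1
  funext T
  have hlog := sum_mul_vandLogDeriv (β := β) (by linarith) T
  have e : ∑ j, (((α + 1) * (1 - T j) - (δ / 2 + 1) * T j) *
      (jacExp z w * vand β : (Fin n → ℝ) → ℝ) T + T j * (1 - T j) * h' j T) =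
      (jacExp z w T * vand β T) * ∑ j, ((α + 1) + (-z - w - (α + δ / 2 + 2)) * T j ^ 1 +
        (3 * w + z) * T j ^ 2 - 2 * w * T j ^ 3) +
      jacExp z w T * ((∑ j, T j * (1 - T j) * vandLogDeriv β j T) * vand β T) := by
    simp only [mul_sum, sum_mul, ← sum_add_distrib]
    refine sum_congr rfl fun j _ => ?_
    simp only [Pi.mul_apply, hh']
    ring
  rw [e, hlog]
  simp only [powSum, sum_add_distrib, sum_sub_distrib, ← mul_sum, sum_const, card_univ, Fintype.card_fin,
    nsmul_eq_mul]
  ring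

lemma jacMoment_loop (hβ : 1 ≤ β) :
    ((α + 1) * n + β * (n * (n - 1) / 2)) * jacMoment β α δ z w n 1 +
      (-z - w - (α + δ / 2 + 2 + β * (n - 1))) * jacMoment β α δ z w n (powSum 1) +
      (3 * w + z) * jacMoment β α δ z w n (powSum 2) -
        2 * w * jacMoment β α δ z w n (powSum 3) = 0 := by
  have hβ0 : 0 ≤ β := zero_le_one.trans hβ
  have hp (k : ℕ) := integrable_mul_jacWeight (α := α) (δ := δ) (z := z) (w := w) hβ0
    (continuous_powSum (ι := Fin n) k)
  have h1 := integrable_mul_jacWeight (α := α) (δ := δ) (z := z) (w := w) hβ0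
    (continuous_const (X := Fin n → ℝ) (y := (1 : ℝ)))
  rw [← integral_loop (α := α) (δ := δ) (z := z) (w := w) (n := n) hβ]
  simp only [jacMoment, Pi.one_apply]
  rw [← integral_const_mul, ← integral_const_mul, ← integral_const_mul, ← integral_const_mul,
    ← integral_add, ← integral_add, ← integral_sub]
  · refine integral_congr_ae (ae_of_all _ fun T => ?_)
    dsimp only
    ring
  · exact ((h1.const_mul _).add ((hp 1).const_mul _)).add ((hp 2).const_mul _)
  · exact (hp 3).const_mul _
  · exact (h1.const_mul _).add ((hp 1).const_mul _)
  · exact (hp 2).const_mul _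
  · exact h1.const_mul _
  · exact (hp 1).const_mul _

lemma jacMoment_loop_deriv (hβ : 1 ≤ β) :
    ((α + 1) * n + β * (n * (n - 1) / 2)) * jacMoment β α δ z w n (powSum 1) +
      (-z - w - (α + δ / 2 + 2 + β * (n - 1))) * jacMoment β α δ z w n (powSum 1 ^ 2) +
      (3 * w + z) * jacMoment β α δ z w n (powSum 1 * powSum 2) -
        2 * w * jacMoment β α δ z w n (powSum 1 * powSum 3) +
      jacMoment β α δ z w n (powSum 1) - jacMoment β α δ z w n (powSum 2) = 0 := by
  have hβ0 : 0 ≤ β := zero_le_one.trans hβ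
  have h1 := hasDerivAt_jacMoment_left (α := α) (δ := δ) (n := n) (f := 1) hβ0 continuous_one z w
  have hp (k : ℕ) := hasDerivAt_jacMoment_left (α := α) (δ := δ) (n := n) hβ0
    (continuous_powSum k) z w
  have hz := hasDerivAt_id z
  have h := (((h1.const_mul ((α + 1) * n + β * (n * (n - 1) / 2))).add
    (((hz.neg.sub_const w).sub_const (α + δ / 2 + 2 + β * (n - 1))).mul (hp 1))).add
    ((hz.const_add (3 * w)).mul (hp 2))).sub ((hp 3).const_mul (2 * w))
  have h0 := h.unique ((hasDerivAt_const z (0 : ℝ)).congr_of_eventuallyEq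
    (Eventually.of_forall fun z => jacMoment_loop hβ))
  simp only [Pi.neg_apply, id, one_mul] at h0
  rw [pow_two, mul_comm (powSum 1) (powSum 2), mul_comm (powSum 1) (powSum 3)]
  linear_combination -h0

end LoopMoments

section Cumulants

variable {n : ℕ} {β α δ : ℝ}

/-- The normalized expectation of `f` in the deformed Jacobi ensemble. -/
noncomputable def jacMean (β α δ z w : ℝ) (n : ℕ) (f : (Fin n → ℝ) → ℝ) : ℝ :=
  jacMoment β α δ z w n f / jacMoment β α δ z w n 1

variable [Fact (-1 < α)] [Fact (-2 < δ)]

lemma cSel_eq_jacMoment (n : ℕ) : cSel β α δ n = jacMoment β α δ 0 0 n 1 := by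
  unfold cSel jacMoment
  rw [integral_jacPi]
  refine integral_congr_ae (ae_of_all _ fun T => ?_)
  simp [jacW, jacExp, jacDensity]

lemma Mjoint_eq_jacMoment_div (n : ℕ) (z w : ℝ) :
    Mjoint β α δ n z w = jacMoment β α δ z w n 1 / cSel β α δ n := by
  unfold Mjoint jacMoment
  rw [integral_jacPi]
  congr 1
  refine integral_congr_ae (ae_of_all _ fun T => ?_)
  simp only [jacW, jacExp, jacDensity, Pi.one_apply]
  ring

lemma cSel_pos (hβ : 0 ≤ β) (n : ℕ) : 0 < cSel β α δ n := by
  rw [cSel_eq_jacMoment]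
  exact jacMoment_one_pos hβ n

lemma exp_sigJoint (hβ : 0 ≤ β) (n : ℕ) (z w : ℝ) :
    Real.exp (sigJoint β α δ n z w) = jacMoment β α δ z w n 1 / cSel β α δ n := by
  rw [sigJoint, Mjoint_eq_jacMoment_div,
    Real.exp_log (div_pos (jacMoment_one_pos hβ n) (cSel_pos hβ n))]

lemma contDiff_sigJoint (hβ : 0 ≤ β) (n : ℕ) :
    ContDiff ℝ (⊤ : ℕ∞) fun p : ℝ × ℝ => sigJoint β α δ n p.1 p.2 := by
  simp only [sigJoint, Mjoint_eq_jacMoment_div]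
  refine ContDiff.log ?_ fun p => (div_pos (jacMoment_one_pos hβ n) (cSel_pos hβ n)).ne'
  exact (contDiff_infty.2 fun k => contDiff_jacMoment hβ k continuous_one).div_const _

lemma hasDerivAt_sigJoint_left (hβ : 0 ≤ β) (z w : ℝ) :
    HasDerivAt (fun z => sigJoint β α δ n z w) (-jacMean β α δ z w n (powSum 1)) z := by
  simp only [sigJoint, Mjoint_eq_jacMoment_div]
  have h0 := (jacMoment_one_pos (α := α) (δ := δ) (z := z) (w := w) hβ n).ne'
  have hc := (cSel_pos (α := α) (δ := δ) hβ n).ne'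
  refine (((hasDerivAt_jacMoment_left (f := 1) hβ continuous_one z w).div_const _).log
    (div_ne_zero h0 hc)).congr_deriv ?_
  rw [one_mul, jacMean]
  field_simp

lemma hasDerivAt_sigJoint_right (hβ : 0 ≤ β) (z w : ℝ) :
    HasDerivAt (fun w => sigJoint β α δ n z w)
      (-jacMean β α δ z w n (powSum 1 - powSum 2)) w := by
  simp only [sigJoint, Mjoint_eq_jacMoment_div]
  have h0 := (jacMoment_one_pos (α := α) (δ := δ) (z := z) (w := w) hβ n).ne'
  have hc := (cSel_pos (α := α) (δ := δ) hβ n).ne'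
  refine (((hasDerivAt_jacMoment_right (f := 1) hβ continuous_one z w).div_const _).log
    (div_ne_zero h0 hc)).congr_deriv ?_
  rw [one_mul, jacMean]
  field_simp

lemma hasDerivAt_jacMean_left (hβ : 0 ≤ β) {f : (Fin n → ℝ) → ℝ} (hf : Continuous f) (z w : ℝ) :
    HasDerivAt (fun z => jacMean β α δ z w n f)
      (jacMean β α δ z w n f * jacMean β α δ z w n (powSum 1) -
        jacMean β α δ z w n (f * powSum 1)) z := by
  have h0 := (jacMoment_one_pos (α := α) (δ := δ) (z := z) (w := w) hβ n).ne'
  refine ((hasDerivAt_jacMoment_left hβ hf z w).div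
    (hasDerivAt_jacMoment_left (f := 1) hβ continuous_one z w) h0).congr_deriv ?_
  rw [one_mul, jacMean, jacMean, jacMean]
  field_simp
  ring

lemma hasDerivAt_jacMean_right (hβ : 0 ≤ β) {f : (Fin n → ℝ) → ℝ} (hf : Continuous f)
    (z w : ℝ) :
    HasDerivAt (fun w => jacMean β α δ z w n f)
      (jacMean β α δ z w n f * jacMean β α δ z w n (powSum 1 - powSum 2) -
        jacMean β α δ z w n (f * (powSum 1 - powSum 2))) w := by
  have h0 := (jacMoment_one_pos (α := α) (δ := δ) (z := z) (w := w) hβ n).ne'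
  refine ((hasDerivAt_jacMoment_right hβ hf z w).div
    (hasDerivAt_jacMoment_right (f := 1) hβ continuous_one z w) h0).congr_deriv ?_
  rw [one_mul, jacMean, jacMean, jacMean]
  field_simp
  ring

lemma jacMean_sub (hβ : 0 ≤ β) {f g : (Fin n → ℝ) → ℝ} (hf : Continuous f) (hg : Continuous g)
    (z w : ℝ) : jacMean β α δ z w n (f - g) = jacMean β α δ z w n f - jacMean β α δ z w n g := by
  have h : jacMoment β α δ z w n (f - g) =
      jacMoment β α δ z w n f - jacMoment β α δ z w n g := by
    unfold jacMoment
    rw [← integral_sub (integrable_mul_jacWeight hβ hf) (integrable_mul_jacWeight hβ hg)]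
    simp only [Pi.sub_apply, sub_mul]
  rw [jacMean, h, sub_div, jacMean, jacMean]

lemma iteratedDeriv_two_sigJoint_left (hβ : 0 ≤ β) (z w : ℝ) :
    iteratedDeriv 2 (fun z => sigJoint β α δ n z w) z =
      jacMean β α δ z w n (powSum 1 ^ 2) - jacMean β α δ z w n (powSum 1) ^ 2 := by
  have h1 : deriv (fun z => sigJoint β α δ n z w) = fun z => -jacMean β α δ z w n (powSum 1) :=
    funext fun z => (hasDerivAt_sigJoint_left hβ z w).deriv
  rw [iteratedDeriv_succ, iteratedDeriv_one, h1, deriv.fun_neg,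
    (hasDerivAt_jacMean_left hβ (continuous_powSum 1) z w).deriv, pow_two (powSum 1)]
  ring

lemma iteratedDeriv_two_sigJoint_right (hβ : 0 ≤ β) (z w : ℝ) :
    iteratedDeriv 2 (fun w => sigJoint β α δ n z w) w =
      jacMean β α δ z w n (powSum 1 ^ 2) - 2 * jacMean β α δ z w n (powSum 1 * powSum 2) +
        jacMean β α δ z w n (powSum 2 ^ 2) -
          (jacMean β α δ z w n (powSum 1) - jacMean β α δ z w n (powSum 2)) ^ 2 := by
  have c (k : ℕ) : Continuous (powSum k : (Fin n → ℝ) → ℝ) := continuous_powSum k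
  have h1 : deriv (fun w => sigJoint β α δ n z w) =
      fun w => -jacMean β α δ z w n (powSum 1 - powSum 2) :=
    funext fun w => (hasDerivAt_sigJoint_right hβ z w).deriv
  have e : (powSum 1 - powSum 2 : (Fin n → ℝ) → ℝ) * (powSum 1 - powSum 2) =
      (powSum 1 ^ 2 - powSum 1 * powSum 2) - (powSum 1 * powSum 2 - powSum 2 ^ 2) := by ring
  rw [iteratedDeriv_succ, iteratedDeriv_one, h1, deriv.fun_neg,
    (hasDerivAt_jacMean_right hβ ((c 1).sub (c 2)) z w).deriv, e,
    jacMean_sub hβ (((c 1).pow 2).sub ((c 1).mul (c 2))) (((c 1).mul (c 2)).sub ((c 2).pow 2)),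
    jacMean_sub hβ ((c 1).pow 2) ((c 1).mul (c 2)),
    jacMean_sub hβ ((c 1).mul (c 2)) ((c 2).pow 2), jacMean_sub hβ (c 1) (c 2)]
  ring

lemma deriv_deriv_sigJoint (hβ : 0 ≤ β) (z w : ℝ) :
    deriv (fun z => deriv (fun w => sigJoint β α δ n z w) w) z =
      jacMean β α δ z w n (powSum 1 ^ 2) - jacMean β α δ z w n (powSum 1 * powSum 2) -
        (jacMean β α δ z w n (powSum 1) - jacMean β α δ z w n (powSum 2)) *
          jacMean β α δ z w n (powSum 1) := by
  have c (k : ℕ) : Continuous (powSum k : (Fin n → ℝ) → ℝ) := continuous_powSum k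
  have h1 : (fun z => deriv (fun w => sigJoint β α δ n z w) w) =
      fun z => -jacMean β α δ z w n (powSum 1 - powSum 2) :=
    funext fun z => (hasDerivAt_sigJoint_right hβ z w).deriv
  have e : (powSum 1 - powSum 2 : (Fin n → ℝ) → ℝ) * powSum 1 =
      powSum 1 ^ 2 - powSum 1 * powSum 2 := by ring
  rw [h1, deriv.fun_neg, (hasDerivAt_jacMean_left hβ ((c 1).sub (c 2)) z w).deriv, e,
    jacMean_sub hβ ((c 1).pow 2) ((c 1).mul (c 2)), jacMean_sub hβ (c 1) (c 2)]
  ring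

lemma iteratedDeriv_four_sigJoint_left (hβ : 0 ≤ β) (z w : ℝ) :
    iteratedDeriv 4 (fun z => sigJoint β α δ n z w) z =
      jacMean β α δ z w n (powSum 1 ^ 4) -
        4 * jacMean β α δ z w n (powSum 1) * jacMean β α δ z w n (powSum 1 ^ 3) -
        3 * jacMean β α δ z w n (powSum 1 ^ 2) ^ 2 +
        12 * jacMean β α δ z w n (powSum 1) ^ 2 * jacMean β α δ z w n (powSum 1 ^ 2) -
        6 * jacMean β α δ z w n (powSum 1) ^ 4 := by
  have hd (k : ℕ) (z : ℝ) := hasDerivAt_jacMean_left (α := α) (δ := δ) hβ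
    ((continuous_powSum (ι := Fin n) 1).pow k) z w
  have h1 := hd 1
  have h2 : iteratedDeriv 2 (fun z => sigJoint β α δ n z w) = fun z =>
      jacMean β α δ z w n (powSum 1 ^ 2) - jacMean β α δ z w n (powSum 1 ^ 1) ^ 2 :=
    funext fun z => by rw [iteratedDeriv_two_sigJoint_left hβ, pow_one (powSum 1)]
  have h3 : iteratedDeriv 3 (fun z => sigJoint β α δ n z w) = fun z =>
      -jacMean β α δ z w n (powSum 1 ^ 3) + 3 * (jacMean β α δ z w n (powSum 1 ^ 1) *
        jacMean β α δ z w n (powSum 1 ^ 2)) - 2 * jacMean β α δ z w n (powSum 1 ^ 1) ^ 3 := by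
    funext z
    rw [iteratedDeriv_succ, h2]
    refine (((hd 2 z).sub ((hd 1 z).pow 2)).congr_deriv ?_).deriv
    rw [← pow_succ, ← pow_succ, pow_one (powSum 1)]
    norm_num
    ring
  rw [iteratedDeriv_succ, h3]
  refine ((((hd 3 z).neg.add (((hd 1 z).mul (hd 2 z)).const_mul 3)).sub
    (((hd 1 z).pow 3).const_mul 2)).congr_deriv ?_).deriv
  rw [← pow_succ, ← pow_succ, ← pow_succ, pow_one (powSum 1)]
  norm_num
  ring

end Cumulants

section Equation

variable {β α δ : ℝ}

lemma choose_two_mul_sub_one {n : ℕ} (hn : 1 ≤ n) :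
    ((2 * n).choose (n - 1) : ℝ) * (n + 1) = (2 * n).choose n * n := by
  obtain ⟨m, rfl⟩ := Nat.exists_eq_add_of_le' hn
  have h := Nat.choose_succ_right_eq (2 * (m + 1)) m
  rw [show 2 * (m + 1) - m = m + 2 by omega] at h
  have h' : ((2 * (m + 1)).choose (m + 1) : ℝ) * (m + 1) = (2 * (m + 1)).choose m * (m + 2) := by
    exact_mod_cast h
  rw [Nat.add_sub_cancel]
  push_cast
  linear_combination -h'

lemma choose_two_mul_sub_two {n : ℕ} (hn : 2 ≤ n) :
    ((2 * n).choose (n - 2) : ℝ) * ((n + 1) * (n + 2)) = (2 * n).choose n * (n * (n - 1)) := by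
  have h1 := choose_two_mul_sub_one (n := n) (by omega)
  obtain ⟨m, rfl⟩ := Nat.exists_eq_add_of_le' hn
  have h := Nat.choose_succ_right_eq (2 * (m + 2)) m
  rw [show 2 * (m + 2) - m = m + 4 by omega] at h
  have h' : ((2 * (m + 2)).choose (m + 1) : ℝ) * (m + 1) = (2 * (m + 2)).choose m * (m + 4) := by
    exact_mod_cast h
  rw [show m + 2 - 1 = m + 1 by omega] at h1
  rw [Nat.add_sub_cancel]
  push_cast at h1 ⊢
  linear_combination (-(m : ℝ) - 3) * h' + (m + 1 : ℝ) * h1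

variable [Fact (-1 < α)] [Fact (-2 < δ)]

lemma jacMean_loop {n : ℕ} (hβ : 1 ≤ β) (z w : ℝ) :
    (-z - w - (α + δ / 2 + 2 + β * (n - 1))) *
        (jacMean β α δ z w n (powSum 1 ^ 2) - jacMean β α δ z w n (powSum 1) ^ 2) +
      (3 * w + z) * (jacMean β α δ z w n (powSum 1 * powSum 2) -
        jacMean β α δ z w n (powSum 1) * jacMean β α δ z w n (powSum 2)) -
      2 * w * (jacMean β α δ z w n (powSum 1 * powSum 3) -
        jacMean β α δ z w n (powSum 1) * jacMean β α δ z w n (powSum 3)) +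
      jacMean β α δ z w n (powSum 1) - jacMean β α δ z w n (powSum 2) = 0 := by
  have h0 := (jacMoment_one_pos (α := α) (δ := δ) (z := z) (w := w) (zero_le_one.trans hβ) n).ne'
  have h1 := jacMoment_loop (α := α) (δ := δ) (z := z) (w := w) (n := n) hβ
  have h2 := jacMoment_loop_deriv (α := α) (δ := δ) (z := z) (w := w) (n := n) hβ
  unfold jacMean
  field_simp
  linear_combination (2 * jacMoment β α δ z w n 1) * h2 -
    2 * jacMoment β α δ z w n (powSum 1) * h1

lemma jacMean_bilinear {η c s n : ℕ} (hp : IsSplitParam β η c s) (hs : c = 0 ∨ s ≤ n) {r : ℝ}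
    (hr : ((2 * n).choose (n - s) : ℝ) * c = (2 * n).choose n * (2 * r)) (z w : ℝ) :
    η * (jacMean β α δ z w n (powSum 1 ^ 4) -
        4 * (jacMean β α δ z w n (powSum 1) * jacMean β α δ z w n (powSum 1 ^ 3)) +
        3 * jacMean β α δ z w n (powSum 1 ^ 2) ^ 2) +
      3 * (jacMean β α δ z w n (powSum 2 ^ 2) - jacMean β α δ z w n (powSum 2) ^ 2) -
      4 * (jacMean β α δ z w n (powSum 1 * powSum 3) -
        jacMean β α δ z w n (powSum 1) * jacMean β α δ z w n (powSum 3)) =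
    r * (jacMoment β α δ z w (n - s) 1 * jacMoment β α δ z w (n + s) 1 /
      jacMoment β α δ z w n 1 ^ 2) := by
  have hβ : 0 ≤ β := by
    rcases hp with h | h | h <;> rw [h.1] <;> norm_num
  have h0 := (jacMoment_one_pos (α := α) (δ := δ) (z := z) (w := w) hβ n).ne'
  have hb : ((2 * n).choose n : ℝ) ≠ 0 := Nat.cast_ne_zero.2 (Nat.choose_pos (by omega)).ne'
  have h := jacMoment_bilinear (α := α) (δ := δ) (z := z) (w := w) hp hs
  rw [← mul_assoc ((2 * n).choose (n - s) : ℝ), hr, mul_assoc, mul_right_inj' hb] at h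
  unfold jacMean
  field_simp
  linear_combination h / 2

lemma sigJoint_pde {η c s n : ℕ} (hp : IsSplitParam β η c s) (hs : c = 0 ∨ s ≤ n) {r : ℝ}
    (hr : ((2 * n).choose (n - s) : ℝ) * c = (2 * n).choose n * (2 * r)) (z w : ℝ) :
    η * w * iteratedDeriv 4 (fun z => sigJoint β α δ n z w) z +
        6 * η * w * iteratedDeriv 2 (fun z => sigJoint β α δ n z w) z ^ 2 +
        2 * z * deriv (fun z => deriv (fun w => sigJoint β α δ n z w) w) z +
        3 * w * iteratedDeriv 2 (fun w => sigJoint β α δ n z w) w +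
        2 * deriv (fun w => sigJoint β α δ n z w) w +
        (2 * (α + δ / 2 + n * β + 2 - β) - w) *
          iteratedDeriv 2 (fun z => sigJoint β α δ n z w) z =
      r * w * (jacMoment β α δ z w (n - s) 1 * jacMoment β α δ z w (n + s) 1 /
        jacMoment β α δ z w n 1 ^ 2) := by
  have hβ : 1 ≤ β := by
    rcases hp with h | h | h <;> rw [h.1] <;> norm_num
  have hβ0 : 0 ≤ β := zero_le_one.trans hβ
  have h1 := jacMean_loop (α := α) (δ := δ) (n := n) hβ z w
  have h2 := jacMean_bilinear (α := α) (δ := δ) hp hs hr z w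
  rw [iteratedDeriv_four_sigJoint_left hβ0, iteratedDeriv_two_sigJoint_left hβ0,
    iteratedDeriv_two_sigJoint_right hβ0, deriv_deriv_sigJoint hβ0,
    (hasDerivAt_sigJoint_right hβ0 z w).deriv,
    jacMean_sub hβ0 (continuous_powSum 1) (continuous_powSum 2)]
  linear_combination w * h2 - 2 * h1

lemma exp_sigJoint_shift (hβ : 0 ≤ β) (n s : ℕ) (z w : ℝ) :
    cSel β α δ (n - s) * cSel β α δ (n + s) / cSel β α δ n ^ 2 *
      Real.exp (sigJoint β α δ (n - s) z w + sigJoint β α δ (n + s) z w -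
        2 * sigJoint β α δ n z w) =
    jacMoment β α δ z w (n - s) 1 * jacMoment β α δ z w (n + s) 1 /
      jacMoment β α δ z w n 1 ^ 2 := by
  rw [Real.exp_sub, Real.exp_add, two_mul, Real.exp_add, exp_sigJoint hβ, exp_sigJoint hβ,
    exp_sigJoint hβ]
  have h (m : ℕ) := (cSel_pos (α := α) (δ := δ) hβ m).ne'
  have h0 := (jacMoment_one_pos (α := α) (δ := δ) (z := z) (w := w) hβ n).ne'
  have := h n; have := h (n - s); have := h (n + s)
  field_simp

end Equation

/-- The nonlinear PDE satisfied by the mixed cumulant generating function of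
conductance and shot noise, for `β ∈ {1,2,4}`. -/
theorem joint_cgf_pde
    (β α δ : ℝ) (hβ : β = 1 ∨ β = 2 ∨ β = 4) (hα : -1 < α) (hδ : -2 < δ)
    (n : ℕ) (hn : 1 ≤ n) (hn1 : β = 1 → 3 ≤ n) (hn4 : β = 4 → 2 ≤ n) :
    (∀ m : ℕ, ContDiff ℝ (⊤ : ℕ∞) (fun p : ℝ × ℝ => sigJoint β α δ m p.1 p.2)) ∧
    ∀ z w : ℝ,
      eta β * w * iteratedDeriv 4 (fun z' => sigJoint β α δ n z' w) z
        + 6 * eta β * w * (iteratedDeriv 2 (fun z' => sigJoint β α δ n z' w) z) ^ 2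
        + 2 * z * deriv (fun z' => deriv (fun w' => sigJoint β α δ n z' w') w) z
        + 3 * w * iteratedDeriv 2 (fun w' => sigJoint β α δ n z w') w
        + 2 * deriv (fun w' => sigJoint β α δ n z w') w
        + (2 * (α + δ / 2 + n * β + 2 - β) - w) *
            iteratedDeriv 2 (fun z' => sigJoint β α δ n z' w) z
      = (12 * bcoef β α δ n / β) * w *
          Real.exp (sigJoint β α δ (n - ibeta β) z w + sigJoint β α δ (n + ibeta β) z w
            - 2 * sigJoint β α δ n z w) := by
  have : Fact (-1 < α) := ⟨hα⟩
  have : Fact (-2 < δ) := ⟨hδ⟩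
  refine ⟨contDiff_sigJoint (by rcases hβ with rfl | rfl | rfl <;> norm_num), fun z w => ?_⟩
  rcases hβ with rfl | rfl | rfl
  · have hn2 : 2 ≤ n := by have := hn1 rfl; omega
    have h := sigJoint_pde (α := α) (δ := δ) (Or.inl ⟨rfl, rfl, rfl, rfl⟩) (Or.inr hn2)
      (r := 12 * ((n : ℝ) * (n - 1) / ((n + 1) * (n + 2)))) (by
        have := choose_two_mul_sub_two hn2
        field_simp
        push_cast
        linear_combination 24 * this) z w
    have e : eta 1 = 1 := by norm_num [eta]
    have i : ibeta 1 = 2 := by norm_num [ibeta]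
    rw [e, i, bcoef, if_pos rfl]
    rw [← exp_sigJoint_shift zero_le_one, Nat.cast_one] at h
    rw [h]
    ring
  · have h := sigJoint_pde (α := α) (δ := δ) (n := n) (r := 0)
      (Or.inr (Or.inl ⟨rfl, rfl, rfl, rfl⟩)) (Or.inl rfl) (by simp) z w
    have e : eta 2 = 1 := by norm_num [eta]
    have b : bcoef 2 α δ n = 0 := by norm_num [bcoef]
    rw [Nat.cast_one] at h
    rw [e, b, h]
    ring
  · have h := sigJoint_pde (α := α) (δ := δ) (Or.inr (Or.inr ⟨rfl, rfl, rfl, rfl⟩)) (Or.inr hn)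
      (r := 3 * ((n : ℝ) / (n + 1))) (by
        have := choose_two_mul_sub_one hn
        field_simp
        push_cast
        linear_combination 6 * this) z w
    have e : eta 4 = 4 := by norm_num [eta]
    have i : ibeta 4 = 1 := by norm_num [ibeta]
    rw [e, i, bcoef, if_neg (by norm_num), if_pos rfl]
    rw [← exp_sigJoint_shift (by norm_num)] at h
    push_cast at h
    rw [h]
    ring
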